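/- Let G be a finite non-cyclic 2-generated group. If the number of ordered pairs (x, y) ∈ G × G with ⟨x, y⟩ = G is strictly less than 6·|G|, then G is isomorphic to one of the following groups: C2 × C2, D3 (the dihedral group of order 6), D4 (the dihedral group of order 8), Q8 (the quaternion group of order 8), C4 × C2, D6 (the dihedral group of order 12), C3 × C3, A4 (the alternating group on 4 letters), or C2 × C2 × C3. -/

import Mathlib

namespace GenPairs
universe u
open scoped commutatorElement
variable {G : Type u} [Group G]

/-- `x` and `y` generate `G`. -/
def Gen (x y : G) : Prop := Subgroup.closure {x, y} = ⊤

/-- number of generating pairs -/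
noncomputable def gp (G : Type u) [Group G] : ℕ := Nat.card {p : G × G // Gen p.1 p.2}

theorem gen_iff {x y : G} : Gen x y ↔ ∀ K : Subgroup G, x ∈ K → y ∈ K → K = ⊤ := by
  unfold Gen
  constructor
  · intro h K hx hy
    rw [eq_top_iff, ← h, Subgroup.closure_le]
    rintro z (rfl | rfl) <;> assumption
  · intro h
    exact h _ (Subgroup.subset_closure (by simp)) (Subgroup.subset_closure (by simp))

theorem Gen.mk' {x y u v : G} (h : Gen x y)
    (h' : ∀ K : Subgroup G, u ∈ K → v ∈ K → x ∈ K ∧ y ∈ K) : Gen u v :=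
  gen_iff.2 fun K hu hv => gen_iff.1 h K (h' K hu hv).1 (h' K hu hv).2

theorem Gen.swap {x y : G} (h : Gen x y) : Gen y x := h.mk' fun _ hu hv => ⟨hv, hu⟩

theorem Gen.right_mul {x y : G} (h : Gen x y) : Gen x (y * x) :=
  h.mk' fun K hu hv => ⟨hu, by simpa using K.mul_mem hv (K.inv_mem hu)⟩

theorem Gen.left_mul {x y : G} (h : Gen x y) : Gen x (x * y) :=
  h.mk' fun K hu hv => ⟨hu, by simpa using K.mul_mem (K.inv_mem hu) hv⟩

theorem Gen.map {Q : Type*} [Group Q] {f : G →* Q} (hf : Function.Surjective f) {x y : G}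
    (h : Gen x y) : Gen (f x) (f y) := by
  rw [gen_iff]
  intro K hx hy
  have := gen_iff.1 h (K.comap f) hx hy
  rw [eq_top_iff]
  intro q _
  obtain ⟨g, rfl⟩ := hf q
  have : g ∈ K.comap f := this ▸ Subgroup.mem_top g
  exact this

theorem Gen.conj {x y : G} (h : Gen x y) (g : G) : Gen (g * x * g⁻¹) (g * y * g⁻¹) :=
  h.map (f := (MulAut.conj g).toMonoidHom) (MulAut.conj g).surjective

theorem Gen.central {x y c : G} (h : Gen x y) (hx : c * x = x * c) (hy : c * y = y * c) :
    c ∈ Subgroup.center G := by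
  have := gen_iff.1 h (Subgroup.centralizer {c})
    (by rw [Subgroup.mem_centralizer_singleton_iff]; exact hx.symm)
    (by rw [Subgroup.mem_centralizer_singleton_iff]; exact hy.symm)
  rw [Subgroup.mem_center_iff]
  intro g
  have hg : g ∈ Subgroup.centralizer {c} := this ▸ Subgroup.mem_top g
  exact Subgroup.mem_centralizer_singleton_iff.1 hg

/-- conjugacy of pairs -/
def Cj (p q : G × G) : Prop := ∃ g : G, g * p.1 * g⁻¹ = q.1 ∧ g * p.2 * g⁻¹ = q.2

def cjSetoid (G : Type u) [Group G] : Setoid {p : G × G // Gen p.1 p.2} where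
  r p q := Cj p.1 q.1
  iseqv := by
    refine ⟨fun p => ⟨1, by simp, by simp⟩, ?_, ?_⟩
    · rintro p q ⟨g, h1, h2⟩
      exact ⟨g⁻¹, by rw [← h1]; group, by rw [← h2]; group⟩
    · rintro p q r ⟨g, h1, h2⟩ ⟨k, h3, h4⟩
      exact ⟨k * g, by rw [← h3, ← h1]; group, by rw [← h4, ← h2]; group⟩

/-- classes of generating pairs -/
def Om (G : Type u) [Group G] : Type u := Quotient (cjSetoid G)

noncomputable instance [Finite G] : Finite (Om G) := by unfold Om; infer_instance

def cls {x y : G} (h : Gen x y) : Om G := Quotient.mk (cjSetoid G) ⟨(x, y), h⟩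

theorem cls_eq {x y u v : G} (h : Gen x y) (k : Gen u v) :
    cls h = cls k ↔ ∃ g : G, g * x * g⁻¹ = u ∧ g * y * g⁻¹ = v := by
  unfold cls
  exact Quotient.eq (r := cjSetoid G)

theorem Om.ind {P : Om G → Prop} (h : ∀ (x y : G) (hh : Gen x y), P (cls hh)) (ω : Om G) : P ω := by
  refine Quotient.inductionOn ω ?_
  rintro ⟨⟨x, y⟩, hh⟩
  exact h x y hh

/-- order type -/
noncomputable def oty : Om G → ℕ × ℕ :=
  Quotient.lift (fun p : {p : G × G // Gen p.1 p.2} => (orderOf p.1.1, orderOf p.1.2)) (by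
    rintro ⟨⟨x, y⟩, h⟩ ⟨⟨u, v⟩, k⟩ ⟨g, h1, h2⟩
    dsimp only at *
    rw [← h1, ← h2]
    have key : ∀ z : G, orderOf (g * z * g⁻¹) = orderOf z := fun z =>
      (MulAut.conj g).orderOf_eq z
    rw [key, key])

@[simp] theorem oty_cls {x y : G} (h : Gen x y) : oty (cls h) = (orderOf x, orderOf y) := rfl

theorem gp_eq_Om [Finite G] (hZ : Subgroup.center G = ⊥) : gp G = Nat.card (Om G) * Nat.card G := by
  rw [← Nat.card_prod]
  unfold gp
  symm
  let F : Om G × G → {p : G × G // Gen p.1 p.2} := fun w =>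
    ⟨(w.2 * (Quotient.out w.1).1.1 * w.2⁻¹, w.2 * (Quotient.out w.1).1.2 * w.2⁻¹),
      (Quotient.out w.1).2.conj w.2⟩
  have hF : ∀ w, (Quotient.mk (cjSetoid G) (F w)) = w.1 := by
    intro w
    conv_rhs => rw [← Quotient.out_eq w.1]
    apply Quotient.sound
    exact (cjSetoid G).iseqv.symm ⟨w.2, rfl, rfl⟩
  refine Nat.card_congr (Equiv.ofBijective F ⟨?_, ?_⟩)
  · rintro ⟨a, g⟩ ⟨b, k⟩ h
    have hab : a = b := (hF (a, g)).symm.trans ((congrArg _ h).trans (hF (b, k)))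
    subst hab
    simp only [F, Subtype.mk.injEq, Prod.mk.injEq] at h
    have hc : k⁻¹ * g ∈ Subgroup.center G := by
      refine (Quotient.out a).2.central ?_ ?_
      · have := h.1
        calc k⁻¹ * g * (Quotient.out a).1.1 = k⁻¹ * (g * (Quotient.out a).1.1 * g⁻¹) * g := by group
          _ = _ := by rw [this]; group
      · have := h.2
        calc k⁻¹ * g * (Quotient.out a).1.2 = k⁻¹ * (g * (Quotient.out a).1.2 * g⁻¹) * g := by group
          _ = _ := by rw [this]; group
    rw [hZ, Subgroup.mem_bot] at hc
    rw [inv_mul_eq_one.1 hc]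
  · intro p
    have : (cjSetoid G).r (Quotient.out (Quotient.mk (cjSetoid G) p)) p :=
      Quotient.exact (Quotient.out_eq (Quotient.mk (cjSetoid G) p))
    obtain ⟨g, h1, h2⟩ := this
    refine ⟨(Quotient.mk (cjSetoid G) p, g), ?_⟩
    apply Subtype.ext
    exact Prod.ext h1 h2

/-- number of generating lifts -/
noncomputable def lifts {Q : Type*} [Group Q] (f : G →* Q) (a b : Q) : ℕ :=
  Nat.card {p : G × G // Gen p.1 p.2 ∧ f p.1 = a ∧ f p.2 = b}

open Classical in
theorem gaschutz_aux [Finite G] {Q : Type*} [Group Q] (f : G →* Q)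
    {a b a' b' : Q} (h : Gen a b) (h' : Gen a' b') (H : Subgroup G) :
    Nat.card {p : G × G // Subgroup.closure {p.1, p.2} = H ∧ f p.1 = a ∧ f p.2 = b} =
    Nat.card {p : G × G // Subgroup.closure {p.1, p.2} = H ∧ f p.1 = a' ∧ f p.2 = b'} := by
  have := Fintype.ofFinite G
  induction H using WellFoundedLT.induction with
  | ind H ih =>
  have mono : ∀ {a b : Q}, Gen a b → ∀ p : G × G, Subgroup.closure {p.1, p.2} ≤ H →
      f p.1 = a → f p.2 = b → H.map f = ⊤ := by
    intro a b h p hp h1 h2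
    refine gen_iff.1 h _ ?_ ?_
    · exact ⟨p.1, hp (Subgroup.subset_closure (by simp)), h1⟩
    · exact ⟨p.2, hp (Subgroup.subset_closure (by simp)), h2⟩
  by_cases hH : H.map f = ⊤
  swap
  · have e1 : IsEmpty {p : G × G // Subgroup.closure {p.1, p.2} = H ∧ f p.1 = a ∧ f p.2 = b} :=
      ⟨fun p => hH (mono h p.1 p.2.1.le p.2.2.1 p.2.2.2)⟩
    have e2 : IsEmpty {p : G × G // Subgroup.closure {p.1, p.2} = H ∧ f p.1 = a' ∧ f p.2 = b'} :=
      ⟨fun p => hH (mono h' p.1 p.2.1.le p.2.2.1 p.2.2.2)⟩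
    rw [Nat.card_eq_zero.2 (Or.inl e1), Nat.card_eq_zero.2 (Or.inl e2)]
  have hs : ∀ q : Q, ∃ g ∈ H, f g = q := by
    intro q
    have : q ∈ H.map f := hH ▸ Subgroup.mem_top q
    exact this
  obtain ⟨s, hsH, hsq⟩ := hs (a' * a⁻¹)
  obtain ⟨t, htH, htq⟩ := hs (b' * b⁻¹)
  let S : Q → Q → Finset (G × G) := fun a b =>
    Finset.univ.filter (fun p => Subgroup.closure {p.1, p.2} ≤ H ∧ f p.1 = a ∧ f p.2 = b)
  have cl : ∀ x y : G, Subgroup.closure {x, y} ≤ H ↔ x ∈ H ∧ y ∈ H := by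
    intro x y
    rw [Subgroup.closure_le]
    simp [Set.insert_subset_iff]
  have hS : (S a b).card = (S a' b').card := by
    refine Finset.card_bij' (fun p _ => (s * p.1, t * p.2)) (fun p _ => (s⁻¹ * p.1, t⁻¹ * p.2))
      ?_ ?_ ?_ ?_
    · intro p hp
      simp only [S, Finset.mem_filter, Finset.mem_univ, true_and, cl] at hp ⊢
      refine ⟨⟨H.mul_mem hsH hp.1.1, H.mul_mem htH hp.1.2⟩, ?_, ?_⟩
      · rw [map_mul, hsq, hp.2.1]; group
      · rw [map_mul, htq, hp.2.2]; group
    · intro p hp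
      simp only [S, Finset.mem_filter, Finset.mem_univ, true_and, cl] at hp ⊢
      refine ⟨⟨H.mul_mem (H.inv_mem hsH) hp.1.1, H.mul_mem (H.inv_mem htH) hp.1.2⟩, ?_, ?_⟩
      · rw [map_mul, map_inv, hsq, hp.2.1]; group
      · rw [map_mul, map_inv, htq, hp.2.2]; group
    · intro p _; simp
    · intro p _; simp
  have dec : ∀ a b : Q, (S a b).card = ∑ K ∈ Finset.univ.filter (fun K : Subgroup G => K ≤ H),
      Nat.card {p : G × G // Subgroup.closure {p.1, p.2} = K ∧ f p.1 = a ∧ f p.2 = b} := by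
    intro a b
    rw [Finset.card_eq_sum_card_fiberwise (f := fun p => Subgroup.closure {p.1, p.2})
      (t := Finset.univ.filter (fun K : Subgroup G => K ≤ H))]
    · apply Finset.sum_congr rfl
      intro K hK
      simp only [Finset.mem_filter, Finset.mem_univ, true_and] at hK
      rw [Nat.card_eq_fintype_card, Fintype.card_subtype]
      congr 1
      ext p
      simp only [S, Finset.mem_filter, Finset.mem_univ, true_and]
      constructor
      · rintro ⟨⟨_, h2, h3⟩, h1⟩; exact ⟨h1, h2, h3⟩
      · rintro ⟨h1, h2, h3⟩; exact ⟨⟨h1.le.trans hK, h2, h3⟩, h1⟩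
    · intro p hp
      simp only [S, Finset.coe_filter, Finset.mem_univ, true_and, Set.mem_ofPred_eq] at hp ⊢
      exact hp.1
  have hmem : H ∈ Finset.univ.filter (fun K : Subgroup G => K ≤ H) := by simp
  rw [dec a b, dec a' b',
    ← Finset.add_sum_erase _ (fun K : Subgroup G => Nat.card {p : G × G // Subgroup.closure {p.1, p.2} = K ∧ f p.1 = a ∧ f p.2 = b}) hmem,
    ← Finset.add_sum_erase _ (fun K : Subgroup G => Nat.card {p : G × G // Subgroup.closure {p.1, p.2} = K ∧ f p.1 = a' ∧ f p.2 = b'}) hmem] at hS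
  rw [Finset.sum_congr rfl (g := fun K => Nat.card {p : G × G // Subgroup.closure {p.1, p.2} = K ∧ f p.1 = a' ∧ f p.2 = b'})] at hS
  · exact Nat.add_right_cancel hS
  · intro K hK
    simp only [Finset.mem_erase, Finset.mem_filter, Finset.mem_univ, true_and] at hK
    exact ih K (lt_of_le_of_ne hK.2 hK.1)

theorem gaschutz [Finite G] {Q : Type*} [Group Q] (f : G →* Q)
    {a b a' b' : Q} (h : Gen a b) (h' : Gen a' b') : lifts f a b = lifts f a' b' :=
  gaschutz_aux f h h' ⊤

open Classical in
theorem gp_eq_lifts [Finite G] {Q : Type*} [Group Q] (f : G →* Q) (hf : Function.Surjective f)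
    {a b : Q} (h : Gen a b) : gp G = gp Q * lifts f a b := by
  have := Fintype.ofFinite G
  have : Finite Q := Finite.of_surjective f hf
  have := Fintype.ofFinite Q
  unfold gp
  rw [Nat.card_eq_fintype_card, Fintype.card_subtype,
    Finset.card_eq_sum_card_fiberwise (f := fun p => (f p.1, f p.2))
      (t := Finset.univ.filter (fun q : Q × Q => Gen q.1 q.2))]
  · rw [Finset.sum_congr rfl (g := fun _ => lifts f a b), Finset.sum_const, smul_eq_mul]
    · congr 1
      rw [Nat.card_eq_fintype_card, Fintype.card_subtype]
    · intro q hq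
      simp only [Finset.mem_filter, Finset.mem_univ, true_and] at hq
      rw [gaschutz f h hq]
      unfold lifts
      rw [Nat.card_eq_fintype_card, Fintype.card_subtype]
      congr 1
      ext p
      simp only [Finset.mem_filter, Finset.mem_univ, true_and, Prod.ext_iff]
  · intro p hp
    simp only [Finset.coe_filter, Finset.mem_univ, true_and, Set.mem_ofPred_eq] at hp ⊢
    exact hp.map hf

theorem comm_le_of_sup_center {K : Subgroup G} (h : K ⊔ Subgroup.center G = ⊤) :
    commutator G ≤ K := by
  rw [commutator_eq_closure, Subgroup.closure_le]
  rintro _ ⟨g, k, rfl⟩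
  have hg : g ∈ K ⊔ Subgroup.center G := h ▸ Subgroup.mem_top g
  have hk : k ∈ K ⊔ Subgroup.center G := h ▸ Subgroup.mem_top k
  rw [Subgroup.mem_sup_of_normal_right] at hg hk
  obtain ⟨a, ha, z, hz, rfl⟩ := hg
  obtain ⟨b, hb, w, hw, rfl⟩ := hk
  have : ⁅a * z, b * w⁆ = ⁅a, b⁆ := by
    rw [Subgroup.mem_center_iff] at hz hw
    rw [commutatorElement_def, commutatorElement_def, mul_inv_rev, mul_inv_rev]
    calc a * z * (b * w) * (z⁻¹ * a⁻¹) * (w⁻¹ * b⁻¹)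
        = a * (z * (b * w)) * (z⁻¹ * a⁻¹) * (w⁻¹ * b⁻¹) := by group
      _ = a * b * (w * a⁻¹) * (w⁻¹ * b⁻¹) := by rw [← hz]; group
      _ = _ := by rw [← hw]; group
  rw [this]
  exact K.mul_mem (K.mul_mem (K.mul_mem ha hb) (K.inv_mem ha)) (K.inv_mem hb)

/-- Multiplying by central commutators does not affect generation. -/
theorem gen_of_map {Q : Type*} [Group Q] (f : G →* Q)
    (hk : f.ker ≤ Subgroup.center G ⊓ commutator G) {x y : G} (h : Gen (f x) (f y)) : Gen x y := by
  rw [gen_iff]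
  intro K hx hy
  have h1 : K.map f = ⊤ := gen_iff.1 h _ ⟨x, hx, rfl⟩ ⟨y, hy, rfl⟩
  have h2 : K ⊔ f.ker = ⊤ := by
    rw [← Subgroup.comap_map_eq, h1, Subgroup.comap_top]
  have h3 : commutator G ≤ K := comm_le_of_sup_center
    (top_le_iff.1 (h2 ▸ sup_le_sup_left (hk.trans inf_le_left) K))
  rw [← h2, sup_eq_left.2 ((hk.trans inf_le_right).trans h3)]

theorem gp_central [Finite G] {Q : Type*} [Group Q] (f : G →* Q) (hf : Function.Surjective f)
    (hk : f.ker ≤ Subgroup.center G ⊓ commutator G) (h2 : ∃ a b : G, Gen a b) :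
    gp G = gp Q * (Nat.card f.ker) ^ 2 := by
  obtain ⟨a, b, hab⟩ := h2
  rw [gp_eq_lifts f hf (hab.map hf)]
  congr 1
  unfold lifts
  rw [sq, ← Nat.card_prod]
  refine Nat.card_congr ⟨fun p => (⟨p.1.1 * a⁻¹, ?_⟩, ⟨p.1.2 * b⁻¹, ?_⟩),
    fun k => ⟨(k.1 * a, k.2 * b), ?_, ?_, ?_⟩, ?_, ?_⟩
  · rw [MonoidHom.mem_ker, map_mul, p.2.2.1]; simp
  · rw [MonoidHom.mem_ker, map_mul, p.2.2.2]; simp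
  · apply gen_of_map f hk
    have h1 := k.1.2
    have h2 := k.2.2
    rw [MonoidHom.mem_ker] at h1 h2
    simpa [h1, h2] using hab.map hf
  · have h1 := k.1.2
    rw [MonoidHom.mem_ker] at h1
    simp [h1]
  · have h1 := k.2.2
    rw [MonoidHom.mem_ker] at h1
    simp [h1]
  · intro p; simp
  · intro p; simp

theorem gp_congr {H : Type*} [Group H] (e : G ≃* H) : gp G = gp H := by
  unfold gp
  refine Nat.card_congr ((Equiv.prodCongr e.toEquiv e.toEquiv).subtypeEquiv ?_)
  rintro ⟨x, y⟩
  constructor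
  · intro h; exact h.map (f := e.toMonoidHom) e.surjective
  · intro h
    have := h.map (f := e.symm.toMonoidHom) e.symm.surjective
    simpa using this

theorem gp_pos [Finite G] (h2 : ∃ a b : G, Gen a b) : 0 < gp G := by
  obtain ⟨a, b, h⟩ := h2
  have : Nonempty {p : G × G // Gen p.1 p.2} := ⟨⟨(a, b), h⟩⟩
  exact Nat.card_pos

/-- the conjugation lower bound -/
theorem lifts_ab_ge [Finite G] {Q : Type*} [CommGroup Q] (f : G →* Q) {x y : G} (h : Gen x y) :
    Nat.card (G ⧸ Subgroup.center G) ≤ lifts f (f x) (f y) := by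
  unfold lifts
  let F : G → {p : G × G // Gen p.1 p.2 ∧ f p.1 = f x ∧ f p.2 = f y} := fun g =>
    ⟨(g * x * g⁻¹, g * y * g⁻¹), h.conj g, by simp, by simp⟩
  have key : ∀ a b : G, F a = F b → a⁻¹ * b ∈ Subgroup.center G := by
    intro a b hab
    simp only [F, Subtype.mk.injEq, Prod.mk.injEq] at hab
    refine h.central ?_ ?_
    · calc a⁻¹ * b * x = a⁻¹ * (b * x * b⁻¹) * b := by group
        _ = _ := by rw [← hab.1]; group
    · calc a⁻¹ * b * y = a⁻¹ * (b * y * b⁻¹) * b := by group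
        _ = _ := by rw [← hab.2]; group
  refine Nat.card_le_card_of_injective (fun q : G ⧸ Subgroup.center G => F q.out) ?_
  intro p q hpq
  have := key _ _ hpq
  rw [← QuotientGroup.eq] at this
  simpa using this

end GenPairs

namespace GenPairs
universe u
open scoped commutatorElement
variable {G : Type u} [Group G]

theorem abc [Finite G] (S : Set G) (hS : ∀ a ∈ S, ∀ b ∈ S, a * b = b * a) (g : G)
    (hg : ∀ s ∈ S, g * s * g⁻¹ ∈ Subgroup.closure S)
    (hgen : ∀ K : Subgroup G, S ⊆ K → g ∈ K → K = ⊤) (hp : commutator G = ⊤) (z : G) : z = 1 := by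
  set N := Subgroup.closure S with hN
  have hSN : S ⊆ N := Subgroup.subset_closure
  have hcomm : ∀ a ∈ N, ∀ b ∈ N, a * b = b * a := by
    intro a ha b hb
    have h1 : N ≤ Subgroup.centralizer S := by
      rw [hN, Subgroup.closure_le]
      intro s hs
      rw [SetLike.mem_coe, Subgroup.mem_centralizer_iff]
      intro t ht
      exact hS t ht s hs
    have h2 : N ≤ Subgroup.centralizer (N : Set G) := by
      rw [Subgroup.le_centralizer_iff]
      rw [hN, Subgroup.closure_le]
      intro s hs
      rw [SetLike.mem_coe, Subgroup.mem_centralizer_iff]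
      intro t ht
      exact ((Subgroup.mem_centralizer_iff.1 (h1 ht)) s hs).symm
    exact (Subgroup.mem_centralizer_iff.1 (h2 hb)) a ha
  have hgN : ∀ n ∈ N, g * n * g⁻¹ ∈ N := by
    have : N ≤ N.comap (MulAut.conj g).toMonoidHom := by
      conv_lhs => rw [hN]
      rw [Subgroup.closure_le]
      exact hg
    exact this
  have hnorm : N.Normal := by
    rw [← Subgroup.normalizer_eq_top_iff]
    apply hgen
    · exact hSN.trans (Subgroup.le_normalizer)
    · exact Subgroup.mem_normalizer_fintype hgN
  have hcyc : IsCyclic (G ⧸ N) := by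
    refine ⟨QuotientGroup.mk' N g, ?_⟩
    have : (Subgroup.zpowers (QuotientGroup.mk' N g)).comap (QuotientGroup.mk' N) = ⊤ := by
      apply hgen
      · intro s hs
        have : QuotientGroup.mk' N s = 1 := (QuotientGroup.eq_one_iff s).2 (hSN hs)
        rw [SetLike.mem_coe, Subgroup.mem_comap, this]
        exact Subgroup.one_mem _
      · exact Subgroup.mem_zpowers _
    intro q
    obtain ⟨x, rfl⟩ := QuotientGroup.mk'_surjective N q
    have hx : x ∈ (Subgroup.zpowers (QuotientGroup.mk' N g)).comap (QuotientGroup.mk' N) :=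
      this ▸ Subgroup.mem_top x
    exact hx
  have hle : commutator G ≤ N := by
    let c : CommGroup (G ⧸ N) := IsCyclic.commGroup
    rw [commutator_eq_closure, Subgroup.closure_le]
    rintro _ ⟨a, b, rfl⟩
    have : QuotientGroup.mk' N ⁅a, b⁆ = 1 := by
      rw [map_commutatorElement, commutatorElement_eq_one_iff_mul_comm]
      exact c.mul_comm _ _
    exact (QuotientGroup.eq_one_iff _).1 this
  have hNtop : N = ⊤ := top_le_iff.1 (hp ▸ hle)
  have hbot : commutator G ≤ ⊥ := by
    rw [commutator_eq_closure, Subgroup.closure_le]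
    rintro _ ⟨a, b, rfl⟩
    rw [SetLike.mem_coe, Subgroup.mem_bot, commutatorElement_eq_one_iff_mul_comm]
    exact hcomm a (hNtop ▸ Subgroup.mem_top a) b (hNtop ▸ Subgroup.mem_top b)
  have : z ∈ commutator G := hp ▸ Subgroup.mem_top z
  exact Subgroup.mem_bot.1 (hbot this)

/-- a perfect group is not generated by a single element -/
theorem not_cyc [Finite G] [Nontrivial G] (hp : commutator G = ⊤) (g : G)
    (hg : ∀ K : Subgroup G, g ∈ K → K = ⊤) : False := by
  obtain ⟨z, hz⟩ := exists_ne (1 : G)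
  exact hz (abc ∅ (by simp) g (by simp) (fun K _ h => hg K h) hp z)

theorem not_dih [Finite G] [Nontrivial G] (hp : commutator G = ⊤) {x y : G} (h : Gen x y)
    (hx : x ^ 2 = 1) (hy : y ^ 2 = 1) : False := by
  obtain ⟨z, hz⟩ := exists_ne (1 : G)
  have hx' : x⁻¹ = x := by rw [inv_eq_iff_mul_eq_one, ← sq, hx]
  have hy' : y⁻¹ = y := by rw [inv_eq_iff_mul_eq_one, ← sq, hy]
  refine hz (abc {x * y} (by simp) y ?_ ?_ hp z)
  · rintro s rfl
    have : y * (x * y) * y⁻¹ = (x * y)⁻¹ := by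
      have e : (x * y)⁻¹ = y * x := by rw [mul_inv_rev, hx', hy']
      rw [e]; group
    rw [this]
    exact Subgroup.inv_mem _ (Subgroup.subset_closure rfl)
  · intro K h1 h2
    refine gen_iff.1 h K ?_ h2
    have : x * y ∈ K := h1 rfl
    simpa using K.mul_mem this (K.inv_mem h2)

theorem not_333 [Finite G] [Nontrivial G] (hp : commutator G = ⊤) {g h : G} (hgh : Gen g h)
    (h1 : g ^ 3 = 1) (h2 : h ^ 3 = 1) (h3 : (h * g) ^ 3 = 1) : False := by
  obtain ⟨z, hz⟩ := exists_ne (1 : G)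
  have g2 : g * g = g⁻¹ := by rw [eq_inv_iff_mul_eq_one, ← h1]; simp only [pow_succ, pow_zero, one_mul]
  have hh2 : h⁻¹ * h⁻¹ = h := by
    rw [← mul_inv_rev, inv_eq_iff_mul_eq_one, ← h2]; simp only [pow_succ, pow_zero, one_mul]
  have e1 : g⁻¹ * h⁻¹ * g⁻¹ = h * g * h := by
    have : (h * g * h) * (g * h * g) = 1 := by rw [← h3]; simp only [pow_succ, pow_zero, one_mul, mul_assoc]
    rw [eq_comm, eq_mul_inv_iff_mul_eq, eq_mul_inv_iff_mul_eq, eq_inv_iff_mul_eq_one, ← this]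
    group
  have e2 : g * h * g * h = h⁻¹ * g⁻¹ := by
    have : (g * h * g * h) * (g * h) = 1 := by
      have : (g * h * g * h) * (g * h) = h⁻¹ * (h * g) ^ 3 * h := by
        simp only [pow_succ, pow_zero, one_mul]; group
      rw [this, h3]; simp
    rw [← mul_inv_rev, eq_inv_iff_mul_eq_one, this]
  have e3 : h * g * h * g = g⁻¹ * h⁻¹ := by
    have : (h * g * h * g) * (h * g) = 1 := by rw [← h3]; simp only [pow_succ, pow_zero, one_mul, mul_assoc]
    rw [← mul_inv_rev, eq_inv_iff_mul_eq_one, this]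
  have uw : g * h⁻¹ * (h * g * h) = g⁻¹ * h := by rw [← g2]; group
  have wu : (h * g * h) * (g * h⁻¹) = g⁻¹ * h := by
    calc (h * g * h) * (g * h⁻¹) = (h * g * h * g) * h⁻¹ := by group
      _ = g⁻¹ * (h⁻¹ * h⁻¹) := by rw [e3]; group
      _ = _ := by rw [hh2]
  refine hz (abc {g * h⁻¹, h * g * h} ?_ g ?_ ?_ hp z)
  · rintro a (rfl | rfl) b (rfl | rfl)
    · rfl
    · rw [uw, wu]
    · rw [uw, wu]
    · rfl
  · rintro a (rfl | rfl)
    · have : g * (g * h⁻¹) * g⁻¹ = h * g * h := by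
        rw [← e1, ← g2]; group
      rw [this]
      exact Subgroup.subset_closure (by simp)
    · have : g * (h * g * h) * g⁻¹ = ((g * h⁻¹) * (h * g * h))⁻¹ := by
        rw [uw]
        calc g * (h * g * h) * g⁻¹ = (g * h * g * h) * g⁻¹ := by group
          _ = h⁻¹ * (g⁻¹ * g⁻¹) := by rw [e2]; group
          _ = _ := by rw [← mul_inv_rev g g, g2]; group
      rw [this]
      exact Subgroup.inv_mem _ (Subgroup.mul_mem _ (Subgroup.subset_closure (by simp))
        (Subgroup.subset_closure (by simp)))
  · intro K hK hg
    refine gen_iff.1 hgh K hg ?_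
    have : g * h⁻¹ ∈ K := hK (by simp)
    simpa using K.inv_mem (K.mul_mem (K.inv_mem hg) this)

end GenPairs

namespace GenPairs
universe u
open scoped commutatorElement
variable {G : Type u} [Group G]

theorem length_le_natCard {X : Type u} [Finite X] (l : List X) (h : l.Nodup) :
    l.length ≤ Nat.card X := by
  classical
  have := Fintype.ofFinite X
  rw [Nat.card_eq_fintype_card]
  exact h.length_le_card

open Classical in
theorem fix_three {X : Type u} [Finite X] (f : X → X) (hf : ∀ x, f (f (f x)) = x)
    (h : ∀ x, f x ≠ x) : 3 ∣ Nat.card X := by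
  have := Fintype.ofFinite X
  have hp : Fact (Nat.Prime 3) := ⟨by norm_num⟩
  have h1 : (show Function.End X from f) ^ 3 ^ 1 = 1 := by
    funext x
    exact hf x
  have := Equiv.Perm.card_fixedPoints_modEq h1
  have h0 : Fintype.card (Function.fixedPoints (show Function.End X from f)) = 0 := by
    rw [Fintype.card_eq_zero_iff]
    exact ⟨fun x => h x.1 x.2⟩
  rw [h0] at this
  rw [Nat.card_eq_fintype_card]
  exact (Nat.modEq_zero_iff_dvd).1 this

open Classical in
theorem fix_two {X : Type u} [Finite X] (f : X → X) (hf : ∀ x, f (f x) = x)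
    (h : ∀ x, f x ≠ x) : 2 ∣ Nat.card X := by
  have := Fintype.ofFinite X
  have hp : Fact (Nat.Prime 2) := ⟨by norm_num⟩
  have h1 : (show Function.End X from f) ^ 2 ^ 1 = 1 := by
    funext x
    exact hf x
  have := Equiv.Perm.card_fixedPoints_modEq h1
  have h0 : Fintype.card (Function.fixedPoints (show Function.End X from f)) = 0 := by
    rw [Fintype.card_eq_zero_iff]
    exact ⟨fun x => h x.1 x.2⟩
  rw [h0] at this
  rw [Nat.card_eq_fintype_card]
  exact (Nat.modEq_zero_iff_dvd).1 this

theorem Gen.rot {x y : G} (h : Gen x y) : Gen y (x * y)⁻¹ :=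
  h.mk' fun K hu hv => ⟨by simpa using K.mul_mem (K.inv_mem hv) (K.inv_mem hu), hu⟩

theorem cls_congr {x y u v : G} (h : Gen x y) (k : Gen u v) (h1 : x = u) (h2 : y = v) :
    cls h = cls k := by
  subst h1 h2; rfl

theorem conj_mul3 (g a b : G) : g * (a * b) * g⁻¹ = (g * a * g⁻¹) * (g * b * g⁻¹) := by group
theorem conj_inv3 (g a : G) : g * a⁻¹ * g⁻¹ = (g * a * g⁻¹)⁻¹ := by group

def swapOm : Om G → Om G :=
  Quotient.lift (fun p : {p : G × G // Gen p.1 p.2} => cls p.2.swap) (by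
    rintro ⟨⟨x, y⟩, h⟩ ⟨⟨u, v⟩, k⟩ ⟨g, h1, h2⟩
    exact (cls_eq _ _).2 ⟨g, h2, h1⟩)

theorem swapOm_cls {x y : G} (h : Gen x y) : swapOm (cls h) = cls h.swap := rfl

def rotOm : Om G → Om G :=
  Quotient.lift (fun p : {p : G × G // Gen p.1 p.2} => cls p.2.rot) (by
    rintro ⟨⟨x, y⟩, h⟩ ⟨⟨u, v⟩, k⟩ ⟨g, h1, h2⟩
    dsimp only at h1 h2
    exact (cls_eq _ _).2 ⟨g, h2, by rw [conj_inv3, conj_mul3, h1, h2]⟩)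

theorem rotOm_cls {x y : G} (h : Gen x y) : rotOm (cls h) = cls h.rot := rfl

theorem Gen.eq_one (hZ : Subgroup.center G = ⊥) {x y c : G} (h : Gen x y)
    (hx : c * x * c⁻¹ = x) (hy : c * y * c⁻¹ = y) : c = 1 := by
  have := h.central (mul_inv_eq_iff_eq_mul.1 hx) (mul_inv_eq_iff_eq_mul.1 hy)
  rwa [hZ, Subgroup.mem_bot] at this

theorem ne_of_oty {p q : Om G} (h : oty p ≠ oty q) : p ≠ q := fun e => h (by rw [e])

theorem cls_ne_swap {x y u v : G} {h : Gen x y} {k : Gen u v} (hh : cls h ≠ cls k) :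
    cls h.swap ≠ cls k.swap := by
  intro e
  apply hh
  have := congrArg swapOm e
  exact this

theorem orderOf_conj3 (g z : G) : orderOf (g * z * g⁻¹) = orderOf z :=
  (MulAut.conj g).orderOf_eq z

theorem perfect_rot [Finite G] [Nontrivial G] (hp : commutator G = ⊤)
    (hZ : Subgroup.center G = ⊥) {x y : G} (hxy : Gen x y) (hr : rotOm (cls hxy) = cls hxy) :
    6 ≤ Nat.card (Om G) := by
  rw [rotOm_cls, eq_comm, cls_eq] at hr
  obtain ⟨g, h1, h2⟩ := hr
  have h3 : g * (x * y)⁻¹ * g⁻¹ = x := by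
    rw [conj_inv3, conj_mul3, h1, h2]; group
  have hg3 : g ^ 3 = 1 := by
    apply hxy.eq_one hZ
    · calc g ^ 3 * x * (g ^ 3)⁻¹ = g * (g * (g * x * g⁻¹) * g⁻¹) * g⁻¹ := by
            simp only [pow_succ, pow_zero, one_mul]; group
        _ = _ := by rw [h1, h2, h3]
    · calc g ^ 3 * y * (g ^ 3)⁻¹ = g * (g * (g * y * g⁻¹) * g⁻¹) * g⁻¹ := by
            simp only [pow_succ, pow_zero, one_mul]; group
        _ = _ := by rw [h2, h3, h1]
  have hxne : x ≠ y := by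
    rintro rfl
    exact not_cyc hp x fun K hK => gen_iff.1 hxy K hK hK
  have hg1 : g ≠ 1 := by
    rintro rfl
    simp at h1; exact hxne h1
  obtain ⟨h, hh⟩ : ∃ h, h = x * g := ⟨_, rfl⟩
  have hh3 : h ^ 3 = 1 := by
    calc h ^ 3 = x * (g * x * g⁻¹) * (g * (g * x * g⁻¹) * g⁻¹) * g ^ 3 := by
          rw [hh]; simp only [pow_succ, pow_zero, one_mul]; group
      _ = 1 := by rw [h1, h2, hg3]; group
  have hh1 : h ≠ 1 := by
    intro e
    rw [hh] at e
    have : x = g⁻¹ := mul_eq_one_iff_eq_inv.1 e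
    apply hxne
    rw [← h1, this]; group
  have hgen : Gen g h := hxy.mk' fun K hu hv => by
    have hxK : x ∈ K := by
      have := K.mul_mem hv (K.inv_mem hu)
      simpa [hh] using this
    exact ⟨hxK, h1 ▸ K.mul_mem (K.mul_mem hu hxK) (K.inv_mem hu)⟩
  have hp3 : Fact (Nat.Prime 3) := ⟨by norm_num⟩
  have og : orderOf g = 3 := orderOf_eq_prime hg3 hg1
  have oh : orderOf h = 3 := orderOf_eq_prime hh3 hh1
  have hgen' : Gen g⁻¹ h := hgen.mk' fun K hu hv => ⟨by simpa using K.inv_mem hu, hv⟩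
  have oa : orderOf (h * g) ≠ 3 := fun e =>
    not_333 hp hgen hg3 hh3 (e ▸ pow_orderOf_eq_one (h * g))
  have oa' : orderOf (h * g⁻¹) ≠ 3 := fun e =>
    not_333 hp hgen' (by simp [hg3]) hh3 (e ▸ pow_orderOf_eq_one (h * g⁻¹))
  have gA : Gen g (h * g) := hgen.right_mul
  have gB : Gen g (h * g⁻¹) := hgen.mk' fun K hu hv => ⟨hu, by simpa using K.mul_mem hv hu⟩
  have gg : g * g = g⁻¹ := by
    rw [eq_inv_iff_mul_eq_one, ← hg3]; simp only [pow_succ, pow_zero, one_mul]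
  have gC : Gen (h * g) (h * g⁻¹) := gA.mk' fun K hu hv => by
    have h1 := K.mul_mem (K.inv_mem hv) hu
    have h2 : (h * g⁻¹)⁻¹ * (h * g) = g⁻¹ := by
      refine Eq.trans ?_ gg
      simp [mul_assoc]
    rw [h2] at h1
    exact ⟨by simpa using K.inv_mem h1, hu⟩
  have neAB : cls gA ≠ cls gB := by
    intro e
    rw [cls_eq] at e
    obtain ⟨c, c1, c2⟩ := e
    apply oa
    have : c * h * c⁻¹ = h * g := by
      have : c * h * c⁻¹ = (c * (h * g) * c⁻¹) * (c * g * c⁻¹)⁻¹ := by group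
      rw [this, c1, c2, mul_assoc, ← mul_inv_rev, gg, inv_inv]
    rw [← this, orderOf_conj3, oh]
  have neAB' := cls_ne_swap neAB
  have := length_le_natCard [cls hgen, cls gA, cls gB, cls gA.swap, cls gB.swap, cls gC] (by
    simp only [List.nodup_cons, List.mem_cons, List.not_mem_nil, not_or, or_false, not_false_iff,
      List.nodup_nil, and_true]
    refine ⟨⟨?_, ?_, ?_, ?_, ?_⟩, ⟨?_, ?_, ?_, ?_⟩, ⟨?_, ?_, ?_⟩, ⟨?_, ?_⟩, ?_⟩
    all_goals first
      | exact neAB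
      | exact neAB'
      | (apply ne_of_oty; simp only [oty_cls, og, oh, ne_eq, Prod.mk.injEq]; omega))
  exact this

theorem perfect_swap [Finite G] [Nontrivial G] (hp : commutator G = ⊤)
    (hZ : Subgroup.center G = ⊥) (h3 : Nat.card (Om G) = 3)
    {x y : G} (hxy : Gen x y) (hr : swapOm (cls hxy) = cls hxy) : False := by
  rw [swapOm_cls, eq_comm, cls_eq] at hr
  obtain ⟨g, h1, h2⟩ := hr
  have hg2 : g ^ 2 = 1 := by
    apply hxy.eq_one hZ
    · calc g ^ 2 * x * (g ^ 2)⁻¹ = g * (g * x * g⁻¹) * g⁻¹ := by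
            simp only [pow_succ, pow_zero, one_mul]; group
        _ = _ := by rw [h1, h2]
    · calc g ^ 2 * y * (g ^ 2)⁻¹ = g * (g * y * g⁻¹) * g⁻¹ := by
            simp only [pow_succ, pow_zero, one_mul]; group
        _ = _ := by rw [h2, h1]
  have hxne : x ≠ y := by
    rintro rfl
    exact not_cyc hp x fun K hK => gen_iff.1 hxy K hK hK
  have hg1 : g ≠ 1 := by
    rintro rfl
    simp at h1; exact hxne h1
  have hgi : g⁻¹ = g := by rw [inv_eq_iff_mul_eq_one, ← sq, hg2]
  have hgen : Gen g x := hxy.mk' fun K hu hv =>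
    ⟨hv, h1 ▸ K.mul_mem (K.mul_mem hu hv) (K.inv_mem hu)⟩
  have hp2 : Fact (Nat.Prime 2) := ⟨by norm_num⟩
  have og : orderOf g = 2 := orderOf_eq_prime hg2 hg1
  have key : ∀ {t z : G}, Gen t z → orderOf t = 2 → orderOf z ≠ 2 := by
    intro t z k ht hz
    exact not_dih hp k (ht ▸ pow_orderOf_eq_one t) (hz ▸ pow_orderOf_eq_one z)
  have gA : Gen g (x * g) := hgen.right_mul
  have gC : Gen x (x * g) := hgen.swap.left_mul
  have oa := key hgen og
  have oc := key gA og
  -- four classes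
  have four : ∀ {t z s w : G} (k : Gen t z) (l : Gen s w), orderOf t = 2 → orderOf s = 2 →
      cls k = cls l := by
    intro t z s w k l ht hs
    by_contra hne
    have hne' := cls_ne_swap hne
    have a1 := key k ht
    have a2 := key l hs
    have := length_le_natCard [cls k, cls l, cls k.swap, cls l.swap] (by
      simp only [List.nodup_cons, List.mem_cons, List.not_mem_nil, not_or, or_false, not_false_iff,
        List.nodup_nil, and_true]
      refine ⟨⟨?_, ?_, ?_⟩, ⟨?_, ?_⟩, ?_⟩
      all_goals first
        | exact hne
        | exact hne'
        | (apply ne_of_oty; simp only [oty_cls, ht, hs, ne_eq, Prod.mk.injEq]; omega))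
    simp only [List.length_cons, List.length_nil] at this
    omega
  obtain ⟨t, t1, t2⟩ := (cls_eq _ _).1 (four hgen gA og og)
  have ht2 : t ^ 2 = 1 := by
    apply hgen.eq_one hZ
    · calc t ^ 2 * g * (t ^ 2)⁻¹ = t * (t * g * t⁻¹) * t⁻¹ := by
            simp only [pow_succ, pow_zero, one_mul]; group
        _ = _ := by rw [t1, t1]
    · calc t ^ 2 * x * (t ^ 2)⁻¹ = t * (t * x * t⁻¹) * t⁻¹ := by
            simp only [pow_succ, pow_zero, one_mul]; group
        _ = x * g ^ 2 := by rw [t2, conj_mul3, t1, t2]; simp only [pow_succ, pow_zero, one_mul]; group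
        _ = x := by rw [hg2, mul_one]
  have ht1 : t ≠ 1 := by
    rintro rfl
    apply hg1
    simpa using t2.symm
  have ot : orderOf t = 2 := orderOf_eq_prime ht2 ht1
  have hgt : g = x⁻¹ * (t * x * t⁻¹) := by rw [t2]; group
  have gT : Gen t x := hgen.mk' fun K hu hv =>
    ⟨by rw [hgt]; exact K.mul_mem (K.inv_mem hv) (K.mul_mem (K.mul_mem hu hv) (K.inv_mem hu)), hv⟩
  obtain ⟨h, e1, e2⟩ := (cls_eq _ _).1 (four hgen gT og ot)
  have hti : t⁻¹ = t := by rw [inv_eq_iff_mul_eq_one, ← sq, ht2]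
  -- x⁻¹ t x = g t
  have r0 : x⁻¹ * t * x = g * t := by rw [hgt]; group
  have hx1 : ∀ n : ℤ, h ^ n * x * (h ^ n)⁻¹ = x := by
    have c : Commute h x := mul_inv_eq_iff_eq_mul.1 e2
    intro n
    rw [mul_inv_eq_iff_eq_mul]
    exact (c.zpow_left n)
  let q : ℤ → G := fun n => h ^ n * g * (h ^ n)⁻¹
  have q0 : q 0 = g := by simp [q]
  have q1 : q 1 = t := by simp [q, e1]
  have qs : ∀ m n : ℤ, h ^ m * q n * (h ^ m)⁻¹ = q (m + n) := by
    intro m n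
    simp only [q, zpow_add]; group
  have r1 : ∀ n, x⁻¹ * q (n + 1) * x = q n * q (n + 1) := by
    intro n
    have := congrArg (fun z => h ^ n * z * (h ^ n)⁻¹) r0
    rw [← q0, ← q1, conj_mul3 _ (q 0), qs, qs, add_zero] at this
    rw [← this]
    have hx := hx1 n
    calc x⁻¹ * q (n + 1) * x = (h ^ n * x * (h ^ n)⁻¹)⁻¹ * q (n + 1) * (h ^ n * x * (h ^ n)⁻¹) := by
          rw [hx]
      _ = _ := by rw [← qs n 1]; group
  have cm : ∀ d : ℕ, ∀ n : ℤ, Commute (q n) (q (n + d)) := by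
    intro d
    induction d using Nat.strong_induction_on with
    | _ d ih =>
    intro n
    match d, ih with
    | 0, _ => simp
    | 1, _ =>
      have c0 : Commute (q 0) (q 1) := by
        rw [q0, q1]
        exact (mul_inv_eq_iff_eq_mul.1 t1).symm
      have := congrArg (fun z => h ^ n * z * (h ^ n)⁻¹) c0.eq
      rw [conj_mul3 _ (q 0), conj_mul3 _ (q 1), qs, qs, add_zero] at this
      exact_mod_cast this
    | (d + 2), ih =>
      -- conjugate commutation of q(n+1), q(n+1+(d+1)) by x
      have c1 : Commute (q (n + 1)) (q (n + (d + 1) + 1)) := by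
        have := ih (d + 1) (by omega) (n + 1)
        convert this using 2
        push_cast; ring
      have c2 : Commute (x⁻¹ * q (n + 1) * x) (x⁻¹ * q (n + (d + 1) + 1) * x) := by
        have := congrArg (fun z => x⁻¹ * z * x) c1.eq
        rw [Commute, SemiconjBy]
        calc _ = x⁻¹ * (q (n + 1) * q (n + (d + 1) + 1)) * x := by group
          _ = _ := this
          _ = _ := by group
      rw [r1, r1] at c2
      have a1 : Commute (q n) (q (n + (d + 1))) := by
        have := ih (d + 1) (by omega) n
        exact_mod_cast this
      have a2 : Commute (q (n + 1)) (q (n + (d + 1))) := by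
        have := ih d (by omega) (n + 1)
        convert this using 2
        ring
      have b1 : Commute (q n * q (n + 1)) (q (n + (d + 1))) := a1.mul_left a2
      have b2 : Commute (q n * q (n + 1)) (q (n + (d + 1) + 1)) := by
        have := (b1.inv_right).mul_right c2
        simpa using this
      have b3 : Commute (q n) (q (n + (d + 1) + 1)) := by
        have := b2.mul_left c1.inv_left
        simpa using this
      convert b3 using 2
      push_cast; ring
  obtain ⟨z, hz⟩ := exists_ne (1 : G)
  refine hz (abc (Set.range q) ?_ x⁻¹ ?_ ?_ hp z)
  · rintro _ ⟨m, rfl⟩ _ ⟨n, rfl⟩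
    rcases le_total m n with hmn | hmn
    · obtain ⟨d, rfl⟩ := Int.le.dest hmn
      exact cm d m
    · obtain ⟨d, rfl⟩ := Int.le.dest hmn
      exact (cm d n).symm
  · rintro _ ⟨m, rfl⟩
    have := r1 (m - 1)
    rw [sub_add_cancel] at this
    rw [inv_inv, this]
    exact Subgroup.mul_mem _ (Subgroup.subset_closure ⟨_, rfl⟩) (Subgroup.subset_closure ⟨_, rfl⟩)
  · intro K hK hx
    refine gen_iff.1 hgen K ?_ (by simpa using K.inv_mem hx)
    exact hK ⟨0, q0⟩

theorem perfect [Finite G] [Nontrivial G] (hp : commutator G = ⊤)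
    (hZ : Subgroup.center G = ⊥) (h2 : ∃ a b : G, Gen a b) : 6 * Nat.card G ≤ gp G := by
  rw [gp_eq_Om hZ]
  apply Nat.mul_le_mul_right
  by_contra hlt
  push Not at hlt
  have hno : ∀ ω : Om G, rotOm ω ≠ ω := by
    refine Om.ind ?_
    intro x y h e
    have := perfect_rot hp hZ h e
    omega
  have h3 : 3 ∣ Nat.card (Om G) := fix_three rotOm (by
    refine Om.ind ?_
    intro x y h
    rw [rotOm_cls, rotOm_cls, rotOm_cls]
    apply cls_congr <;> group) hno
  obtain ⟨a, b, hab⟩ := h2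
  have : Nonempty (Om G) := ⟨cls hab⟩
  have hpos : 0 < Nat.card (Om G) := Nat.card_pos
  have h3' : Nat.card (Om G) = 3 := by omega
  have : 2 ∣ Nat.card (Om G) := fix_two swapOm (by
    refine Om.ind ?_
    intro x y h
    rfl) (by
    refine Om.ind ?_
    intro x y h e
    exact perfect_swap hp hZ h3' h e)
  omega

end GenPairs

namespace GenPairs
universe u
open scoped commutatorElement
variable {G : Type u} [Group G]

theorem of_surj : Function.Surjective (Abelianization.of : G →* Abelianization G) :=
  QuotientGroup.mk_surjective

theorem of_ker : (Abelianization.of : G →* Abelianization G).ker = commutator G :=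
  QuotientGroup.ker_mk' _

theorem comm_map {Q : Type*} [Group Q] (f : G →* Q) (hf : Function.Surjective f) :
    (commutator G).map f = commutator Q := by
  rw [commutator_def, commutator_def, Subgroup.map_commutator, Subgroup.map_top_of_surjective f hf]

theorem ab_equiv {Q : Type u} [Group Q] (f : G →* Q) (hf : Function.Surjective f)
    (hk : f.ker ≤ commutator G) : Nonempty (Abelianization G ≃* Abelianization Q) := by
  refine ⟨MulEquiv.ofBijective (Abelianization.map f) ⟨?_, ?_⟩⟩
  · rw [injective_iff_map_eq_one]
    intro a ha
    obtain ⟨x, rfl⟩ := of_surj a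
    rw [Abelianization.map_of] at ha
    have h1 : f x ∈ commutator Q := by rw [← of_ker]; exact ha
    rw [← comm_map f hf] at h1
    obtain ⟨y, hy, hxy⟩ := h1
    have h2 : y⁻¹ * x ∈ f.ker := by
      rw [MonoidHom.mem_ker, map_mul, map_inv, hxy, inv_mul_cancel]
    have h3 : x ∈ commutator G := by
      have := (commutator G).mul_mem hy (hk h2)
      simpa using this
    rw [← of_ker] at h3
    exact h3
  · intro a
    obtain ⟨q, rfl⟩ := of_surj a
    obtain ⟨x, rfl⟩ := hf q
    exact ⟨Abelianization.of x, by simp⟩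

theorem gen_quot {Q : Type*} [Group Q] (f : G →* Q) (hf : Function.Surjective f)
    (h2 : ∃ a b : G, Gen a b) : ∃ a b : Q, Gen a b := by
  obtain ⟨a, b, h⟩ := h2
  exact ⟨_, _, h.map hf⟩

theorem ab_self (h : commutator G = ⊥) : Nonempty (G ≃* Abelianization G) := by
  refine ⟨MulEquiv.ofBijective Abelianization.of ⟨?_, of_surj⟩⟩
  rw [← MonoidHom.ker_eq_bot_iff, of_ker, h]

theorem comm_bot_iff : commutator G = ⊥ ↔ ∀ a b : G, a * b = b * a := by
  rw [eq_bot_iff, commutator_eq_closure, Subgroup.closure_le]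
  constructor
  · intro h a b
    have : ⁅a, b⁆ ∈ (⊥ : Subgroup G) := h ⟨a, b, rfl⟩
    rwa [Subgroup.mem_bot, commutatorElement_eq_one_iff_mul_comm] at this
  · rintro h _ ⟨a, b, rfl⟩
    rw [SetLike.mem_coe, Subgroup.mem_bot, commutatorElement_eq_one_iff_mul_comm, h]

/-- center intersected with commutator -/
abbrev Z0 (G : Type u) [Group G] : Subgroup G := Subgroup.center G ⊓ commutator G

theorem Z0_quot [Finite G] (h2 : ∃ a b : G, Gen a b) :
    gp G = gp (G ⧸ Z0 G) * (Nat.card (Z0 G)) ^ 2 ∧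
    Nat.card G = Nat.card (G ⧸ Z0 G) * Nat.card (Z0 G) ∧
    Nonempty (Abelianization G ≃* Abelianization (G ⧸ Z0 G)) := by
  have hs := QuotientGroup.mk'_surjective (Z0 G)
  refine ⟨?_, Subgroup.card_eq_card_quotient_mul_card_subgroup _, ?_⟩
  · have := gp_central (QuotientGroup.mk' (Z0 G)) hs (by rw [QuotientGroup.ker_mk']) h2
    rwa [QuotientGroup.ker_mk'] at this
  · exact ab_equiv (QuotientGroup.mk' (Z0 G)) hs (by
      rw [QuotientGroup.ker_mk']; exact inf_le_right)

theorem two_le_of_ne_bot [Finite G] {N : Subgroup G} (h : N ≠ ⊥) : 2 ≤ Nat.card N := by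
  have : Nontrivial N := (Subgroup.nontrivial_iff_ne_bot N).2 h
  exact Finite.one_lt_card

theorem gp_Z [Finite G] (h2 : ∃ a b : G, Gen a b) :
    gp (Abelianization G) * Nat.card G ≤ gp G * Nat.card (Subgroup.center G) := by
  obtain ⟨a, b, h⟩ := h2
  rw [gp_eq_lifts Abelianization.of of_surj (h.map of_surj),
    Subgroup.card_eq_card_quotient_mul_card_subgroup (Subgroup.center G)]
  rw [← mul_assoc]
  exact Nat.mul_le_mul_right _ (Nat.mul_le_mul_left _ (lifts_ab_ge _ h))

theorem Z_dvd [Finite G] (h0 : Z0 G = ⊥) :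
    Nat.card (Subgroup.center G) ∣ Nat.card (Abelianization G) := by
  refine Subgroup.card_dvd_of_injective (Abelianization.of.comp (Subgroup.center G).subtype) ?_
  rw [injective_iff_map_eq_one]
  rintro ⟨z, hz⟩ h
  have h1 : z ∈ commutator G := by rw [← of_ker]; exact h
  have : z ∈ Z0 G := ⟨hz, h1⟩
  rw [h0, Subgroup.mem_bot] at this
  exact Subtype.ext this

theorem center_quot (h0 : Z0 G = ⊥) : Subgroup.center (G ⧸ Subgroup.center G) = ⊥ := by
  rw [eq_bot_iff]
  intro q hq
  obtain ⟨w, rfl⟩ := QuotientGroup.mk'_surjective _ q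
  rw [Subgroup.mem_bot]
  refine (QuotientGroup.eq_one_iff w).2 ?_
  rw [Subgroup.mem_center_iff] at hq ⊢
  intro g
  have h1 := hq (QuotientGroup.mk' _ g)
  have h2 : QuotientGroup.mk' (Subgroup.center G) ⁅g, w⁆ = 1 := by
    rw [map_commutatorElement, commutatorElement_eq_one_iff_mul_comm]; exact h1
  have h3 : ⁅g, w⁆ ∈ Subgroup.center G := (QuotientGroup.eq_one_iff _).1 h2
  have h4 : ⁅g, w⁆ ∈ commutator G :=
    Subgroup.commutator_mem_commutator (Subgroup.mem_top g) (Subgroup.mem_top w)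
  have : ⁅g, w⁆ ∈ Z0 G := ⟨h3, h4⟩
  rw [h0, Subgroup.mem_bot] at this
  exact commutatorElement_eq_one_iff_mul_comm.1 this

theorem m_one [Finite G] (h2 : ∃ a b : G, Gen a b) (hn : commutator G ≠ ⊥) (h0 : Z0 G = ⊥)
    (hc : Nat.card (Subgroup.center G) = Nat.card (Abelianization G)) :
    6 * gp (Abelianization G) * Nat.card G ≤ gp G * Nat.card (Abelianization G) := by
  set Z := Subgroup.center G with hZ
  have hinj : Function.Injective (Abelianization.of.comp Z.subtype) := by
    rw [injective_iff_map_eq_one]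
    rintro ⟨z, hz⟩ h
    have h1 : z ∈ commutator G := by rw [← of_ker]; exact h
    have : z ∈ Z0 G := ⟨hz, h1⟩
    rw [h0, Subgroup.mem_bot] at this
    exact Subtype.ext this
  have hbij := (Nat.bijective_iff_injective_and_card _).2 ⟨hinj, hc⟩
  have hs := QuotientGroup.mk'_surjective Z
  have hperf : commutator (G ⧸ Z) = ⊤ := by
    rw [← comm_map _ hs, eq_top_iff]
    intro q _
    obtain ⟨x, rfl⟩ := hs q
    obtain ⟨⟨z, hz⟩, e⟩ := hbij.2 (Abelianization.of x)
    refine ⟨x * z⁻¹, ?_, ?_⟩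
    · rw [SetLike.mem_coe, ← of_ker, MonoidHom.mem_ker, map_mul, map_inv, ← e]
      simp
    · rw [map_mul, map_inv]
      have : QuotientGroup.mk' Z z = 1 := (QuotientGroup.eq_one_iff z).2 hz
      rw [this]; simp
  have hcen : Subgroup.center (G ⧸ Z) = ⊥ := center_quot h0
  have hnt : Nontrivial (G ⧸ Z) := by
    rw [← not_subsingleton_iff_nontrivial, QuotientGroup.subsingleton_iff]
    intro e
    apply hn
    rw [comm_bot_iff]
    intro a b
    have : b ∈ Z := e ▸ Subgroup.mem_top b
    exact (Subgroup.mem_center_iff.1 this) a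
  have hper := perfect hperf hcen (gen_quot _ hs h2)
  have hcard := Subgroup.card_eq_card_quotient_mul_card_subgroup Z
  let F : G →* (G ⧸ Z) × Abelianization G := (QuotientGroup.mk' Z).prod Abelianization.of
  have hFi : Function.Injective F := by
    rw [injective_iff_map_eq_one]
    intro x hx
    have e1 : QuotientGroup.mk' Z x = 1 := congrArg Prod.fst hx
    have e2 : Abelianization.of x = 1 := congrArg Prod.snd hx
    have : x ∈ Z0 G := ⟨(QuotientGroup.eq_one_iff x).1 e1, by rw [← of_ker]; exact e2⟩
    rwa [h0, Subgroup.mem_bot] at this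
  have hFb : Function.Bijective F := (Nat.bijective_iff_injective_and_card _).2
    ⟨hFi, by rw [Nat.card_prod, hcard, hc]⟩
  let e := Equiv.ofBijective F hFb
  have hgen : ∀ x y : G, Gen (QuotientGroup.mk' Z x) (QuotientGroup.mk' Z y) →
      Gen (Abelianization.of x) (Abelianization.of y) → Gen x y := by
    intro x y h1 h2
    rw [gen_iff]
    intro K hx hy
    have k1 : K.map (QuotientGroup.mk' Z) = ⊤ := gen_iff.1 h1 _ ⟨x, hx, rfl⟩ ⟨y, hy, rfl⟩
    have k2 : K.map Abelianization.of = ⊤ := gen_iff.1 h2 _ ⟨x, hx, rfl⟩ ⟨y, hy, rfl⟩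
    have k3 : K ⊔ Z = ⊤ := by
      have := Subgroup.comap_map_eq (QuotientGroup.mk' Z) K
      rw [k1, Subgroup.comap_top, QuotientGroup.ker_mk'] at this
      exact this.symm
    have k4 : K ⊔ commutator G = ⊤ := by
      have := Subgroup.comap_map_eq Abelianization.of K
      rw [k2, Subgroup.comap_top, of_ker] at this
      exact this.symm
    have k5 := comm_le_of_sup_center k3
    rwa [sup_eq_left.2 k5] at k4
  have hprod : gp (G ⧸ Z) * gp (Abelianization G) ≤ gp G := by
    unfold gp
    rw [← Nat.card_prod]
    have hle : ∀ (h : G ⧸ Z) (a : Abelianization G), QuotientGroup.mk' Z (e.symm (h, a)) = h ∧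
        Abelianization.of (e.symm (h, a)) = a := by
      intro h a
      have : F (e.symm (h, a)) = (h, a) := e.apply_symm_apply (h, a)
      exact ⟨congrArg Prod.fst this, congrArg Prod.snd this⟩
    refine Nat.card_le_card_of_injective
      (fun w => (⟨(e.symm (w.1.1.1, w.2.1.1), e.symm (w.1.1.2, w.2.1.2)), hgen _ _
        (by
          have := w.1.2
          rw [(hle _ _).1, (hle _ _).1]; exact this)
        (by
          have := w.2.2
          rw [(hle _ _).2, (hle _ _).2]; exact this)⟩ : {p : G × G // Gen p.1 p.2})) ?_
    rintro ⟨⟨⟨a, b⟩, h1⟩, ⟨⟨c, d⟩, h2⟩⟩ ⟨⟨⟨a', b'⟩, h1'⟩, ⟨⟨c', d'⟩, h2'⟩⟩ hh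
    simp only [Subtype.mk.injEq, Prod.mk.injEq, EmbeddingLike.apply_eq_iff_eq] at hh
    obtain ⟨⟨rfl, rfl⟩, rfl, rfl⟩ := hh
    rfl
  calc 6 * gp (Abelianization G) * Nat.card G
      = (6 * Nat.card (G ⧸ Z)) * gp (Abelianization G) * Nat.card (Abelianization G) := by
        rw [hcard, hc]; ring
    _ ≤ gp (G ⧸ Z) * gp (Abelianization G) * Nat.card (Abelianization G) := by gcongr
    _ ≤ _ := by gcongr

theorem E1_aux (n : ℕ) : ∀ (G : Type u) [Group G] [Finite G], Nat.card G = n →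
    (∃ a b : G, Gen a b) → commutator G ≠ ⊥ →
    2 * gp (Abelianization G) * Nat.card G ≤ gp G * Nat.card (Abelianization G) := by
  induction n using Nat.strong_induction_on with
  | _ n ih =>
  intro G _ _ hn h2 hc
  by_cases h0 : Z0 G = ⊥
  · have hd := Z_dvd h0
    have hz := gp_Z h2
    have hm := m_one h2 hc h0
    obtain ⟨k, hk⟩ := hd
    have hpos : 0 < Nat.card (Abelianization G) := Nat.card_pos
    rcases Nat.lt_or_ge k 2 with hk2 | hk2
    · have : k = 1 := by
        rcases k with _ | _ | k
        · simp at hk; omega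
        · rfl
        · omega
      rw [this, mul_one] at hk
      have := hm hk.symm
      refine le_trans ?_ this
      gcongr; norm_num
    · rw [hk]
      calc 2 * gp (Abelianization G) * Nat.card G
          = 2 * (gp (Abelianization G) * Nat.card G) := by ring
        _ ≤ k * (gp G * Nat.card (Subgroup.center G)) := by gcongr
        _ = _ := by ring
  · obtain ⟨q1, q2, ⟨e⟩⟩ := Z0_quot h2
    have hN := two_le_of_ne_bot h0
    have hs := QuotientGroup.mk'_surjective (Z0 G)
    have h2' := gen_quot _ hs h2
    have ec := Nat.card_congr e.toEquiv
    have eg := gp_congr e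
    by_cases hb : commutator (G ⧸ Z0 G) = ⊥
    · obtain ⟨e'⟩ := ab_self hb
      have ec' := Nat.card_congr e'.toEquiv
      have eg' := gp_congr e'
      rw [q1, q2, ec, eg, ← ec', ← eg']
      calc _ = 2 * (gp (G ⧸ Z0 G) * Nat.card (G ⧸ Z0 G) * Nat.card (Z0 G)) := by ring
        _ ≤ Nat.card (Z0 G) * (gp (G ⧸ Z0 G) * Nat.card (G ⧸ Z0 G) * Nat.card (Z0 G)) := by gcongr
        _ = _ := by ring
    · have hlt : Nat.card (G ⧸ Z0 G) < n := by
        rw [← hn, q2]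
        have : 0 < Nat.card (G ⧸ Z0 G) := Nat.card_pos
        nlinarith
      have := ih _ hlt (G ⧸ Z0 G) rfl h2' hb
      rw [← ec, ← eg] at this
      rw [q1, q2]
      calc _ = (2 * gp (Abelianization G) * Nat.card (G ⧸ Z0 G)) * Nat.card (Z0 G) := by ring
        _ ≤ (gp (G ⧸ Z0 G) * Nat.card (Abelianization G)) * Nat.card (Z0 G) := by gcongr
        _ ≤ (gp (G ⧸ Z0 G) * Nat.card (Abelianization G)) * (Nat.card (Z0 G) * Nat.card (Z0 G)) := by
          gcongr; nlinarith
        _ = _ := by ring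

theorem E1 [Finite G] (h2 : ∃ a b : G, Gen a b) (hc : commutator G ≠ ⊥) :
    2 * gp (Abelianization G) * Nat.card G ≤ gp G * Nat.card (Abelianization G) :=
  E1_aux _ G rfl h2 hc

end GenPairs

namespace GenPairs
universe u
open scoped commutatorElement

theorem ab_struct {A : Type u} [CommGroup A] [Finite A] {x y : A} (h : Gen x y) :
    ∃ a b : ℕ, 0 < a ∧ 0 < b ∧ Nonempty (A ≃* Multiplicative (ZMod a × ZMod b)) := by
  let f : (Fin 2 → ℤ) →ₗ[ℤ] Additive A :=
    Fintype.linearCombination ℤ ![Additive.ofMul x, Additive.ofMul y]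
  have hf : Function.Surjective f := by
    have hr : (AddSubgroup.toSubgroup' f.range.toAddSubgroup : Subgroup A) = ⊤ := by
      apply gen_iff.1 h
      · exact ⟨Pi.single 0 1, by simp [f, Fintype.linearCombination_apply]; rfl⟩
      · exact ⟨Pi.single 1 1, by simp [f, Fintype.linearCombination_apply]; rfl⟩
    intro a
    have : (Additive.toMul a) ∈ (AddSubgroup.toSubgroup' f.range.toAddSubgroup : Subgroup A) :=
      hr ▸ Subgroup.mem_top _
    exact this
  have e1 : ((Fin 2 → ℤ) ⧸ LinearMap.ker f) ≃ₗ[ℤ] Additive A := f.quotKerEquivOfSurjective hf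
  have hfin : Finite ((Fin 2 → ℤ) ⧸ LinearMap.ker f) := Finite.of_equiv _ e1.symm.toEquiv
  have hrank := (Submodule.finiteQuotient_iff (LinearMap.ker f)).1 hfin
  have e2 := Submodule.quotientEquivPiZMod (LinearMap.ker f) (Pi.basisFun ℤ (Fin 2)) hrank
  set c := Submodule.smithNormalFormCoeffs (Pi.basisFun ℤ (Fin 2)) hrank with hc
  have hne : ∀ i, c i ≠ 0 := Submodule.smithNormalFormCoeffs_ne_zero _ _
  refine ⟨(c 0).natAbs, (c 1).natAbs, Int.natAbs_pos.2 (hne 0), Int.natAbs_pos.2 (hne 1), ⟨?_⟩⟩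
  have e3 : Additive A ≃+ (ZMod (c 0).natAbs × ZMod (c 1).natAbs) :=
    (e1.symm.toAddEquiv.trans e2).trans (RingEquiv.piFinTwo (fun i => ZMod (c i).natAbs)).toAddEquiv
  exact AddEquiv.toMultiplicativeRight e3

theorem mul_mem_ofAdd {B : Type*} [AddCommGroup B] (K : Subgroup (Multiplicative B)) {u : B}
    (h : Multiplicative.ofAdd u ∈ K) (k : ℤ) : Multiplicative.ofAdd (k • u) ∈ K := by
  rw [ofAdd_zsmul]; exact K.zpow_mem h k

theorem J_ge (n : ℕ) (hn : 0 < n) : ((Finset.range n ×ˢ Finset.range n).filter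
    (fun p : ℕ × ℕ => Nat.gcd (Nat.gcd p.1 p.2) n = 1)).card ≤ gp (Multiplicative (ZMod n)) := by
  have : NeZero n := ⟨hn.ne'⟩
  set S := (Finset.range n ×ˢ Finset.range n).filter
    (fun p : ℕ × ℕ => Nat.gcd (Nat.gcd p.1 p.2) n = 1) with hS
  have h1 : S.card = Nat.card S := by simp
  rw [h1]
  unfold gp
  have key : ∀ u v : ℕ, Nat.gcd (Nat.gcd u v) n = 1 →
      Gen (Multiplicative.ofAdd (u : ZMod n)) (Multiplicative.ofAdd (v : ZMod n)) := by
    intro u v h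
    rw [gen_iff]
    intro K hu hv
    rw [eq_top_iff]
    intro z _
    obtain ⟨z, rfl⟩ := Multiplicative.ofAdd.surjective z
    have e1 := congrArg (Int.cast : ℤ → ZMod n) (Nat.gcd_eq_gcd_ab u v)
    have e2 := congrArg (Int.cast : ℤ → ZMod n) (Nat.gcd_eq_gcd_ab (Nat.gcd u v) n)
    rw [h] at e2
    push_cast at e1 e2
    rw [CharP.cast_eq_zero (ZMod n) n, zero_mul, add_zero, e1] at e2
    obtain ⟨k, rfl⟩ := ZMod.intCast_surjective z
    have := K.mul_mem (mul_mem_ofAdd K hu (k * Nat.gcdA (Nat.gcd u v) n * Nat.gcdA u v))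
      (mul_mem_ofAdd K hv (k * Nat.gcdA (Nat.gcd u v) n * Nat.gcdB u v))
    rw [← ofAdd_add] at this
    convert this using 2
    simp only [zsmul_eq_mul]
    push_cast
    linear_combination (k : ZMod n) * e2
  refine Nat.card_le_card_of_injective
    (fun p : S => (⟨(Multiplicative.ofAdd (p.1.1 : ZMod n), Multiplicative.ofAdd (p.1.2 : ZMod n)),
      key _ _ (Finset.mem_filter.1 p.2).2⟩ : {p : _ × _ // Gen p.1 p.2})) ?_
  rintro ⟨⟨a, b⟩, h⟩ ⟨⟨c, d⟩, h'⟩ e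
  have ⟨ha, hb⟩ := Finset.mem_product.1 (Finset.mem_filter.1 h).1
  have ⟨hc, hd⟩ := Finset.mem_product.1 (Finset.mem_filter.1 h').1
  simp only [Finset.mem_range] at ha hb hc hd
  simp only [Subtype.mk.injEq, Prod.mk.injEq, EmbeddingLike.apply_eq_iff_eq] at e
  obtain ⟨e1, e2⟩ := e
  rw [ZMod.natCast_eq_natCast_iff', Nat.mod_eq_of_lt ha, Nat.mod_eq_of_lt hc] at e1
  rw [ZMod.natCast_eq_natCast_iff', Nat.mod_eq_of_lt hb, Nat.mod_eq_of_lt hd] at e2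
  subst e1 e2; rfl

theorem gp_prod_ge (a b : ℕ) (ha : 0 < a) (hb : 0 < b) :
    gp (Multiplicative (ZMod b)) * (a * Nat.totient a) ≤ gp (Multiplicative (ZMod a × ZMod b)) := by
  have : NeZero a := ⟨ha.ne'⟩
  have : NeZero b := ⟨hb.ne'⟩
  let f : Multiplicative (ZMod a × ZMod b) →* Multiplicative (ZMod b) :=
    AddMonoidHom.toMultiplicative (AddMonoidHom.snd (ZMod a) (ZMod b))
  have hf : Function.Surjective f := by
    intro z
    exact ⟨Multiplicative.ofAdd (0, Multiplicative.toAdd z), rfl⟩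
  have hg : Gen (Multiplicative.ofAdd (1 : ZMod b)) (Multiplicative.ofAdd (0 : ZMod b)) := by
    rw [gen_iff]
    intro K h1 _
    rw [eq_top_iff]
    intro z _
    obtain ⟨z, rfl⟩ := Multiplicative.ofAdd.surjective z
    obtain ⟨k, rfl⟩ := ZMod.intCast_surjective z
    have := mul_mem_ofAdd K h1 k
    simpa using this
  rw [gp_eq_lifts f hf hg]
  apply Nat.mul_le_mul_left
  have hc : a * Nat.totient a = Nat.card (ZMod a × (ZMod a)ˣ) := by
    rw [Nat.card_prod, Nat.card_zmod, Nat.card_eq_fintype_card, ZMod.card_units_eq_totient]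
  rw [hc]
  unfold lifts
  have key : ∀ (u : ZMod a) (v : (ZMod a)ˣ), Gen (Multiplicative.ofAdd ((u, 1) : ZMod a × ZMod b))
      (Multiplicative.ofAdd (((v : ZMod a), 0) : ZMod a × ZMod b)) := by
    intro u v
    rw [gen_iff]
    intro K hu hv
    rw [eq_top_iff]
    intro z _
    obtain ⟨⟨s, t⟩, rfl⟩ := Multiplicative.ofAdd.surjective z
    obtain ⟨k, rfl⟩ := ZMod.intCast_surjective t
    obtain ⟨m, hm⟩ := ZMod.intCast_surjective ((s - (k : ZMod a) * u) * ((v⁻¹ : (ZMod a)ˣ) : ZMod a))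
    have := K.mul_mem (mul_mem_ofAdd K hu k) (mul_mem_ofAdd K hv m)
    rw [← ofAdd_add] at this
    convert this using 2
    ext
    · simp [hm]
    · simp
  refine Nat.card_le_card_of_injective
    (fun p : ZMod a × (ZMod a)ˣ => (⟨(Multiplicative.ofAdd ((p.1, 1) : ZMod a × ZMod b),
      Multiplicative.ofAdd (((p.2 : ZMod a), 0) : ZMod a × ZMod b)), key _ _, rfl, rfl⟩ :
      {p : _ × _ // Gen p.1 p.2 ∧ f p.1 = _ ∧ f p.2 = _})) ?_
  rintro ⟨u, v⟩ ⟨u', v'⟩ e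
  have e' := congrArg Subtype.val e
  have h1 : u = u' := congrArg (fun w => (Multiplicative.toAdd w.1).1) e'
  have h2 : (v : ZMod a) = v' := congrArg (fun w => (Multiplicative.toAdd w.2).1) e'
  obtain rfl := h1
  obtain rfl := Units.ext h2
  rfl

theorem gp_prod_comm (a b : ℕ) : gp (Multiplicative (ZMod a × ZMod b)) =
    gp (Multiplicative (ZMod b × ZMod a)) :=
  gp_congr (AddEquiv.toMultiplicative AddEquiv.prodComm)

theorem J_ge_totient (n : ℕ) (hn : 0 < n) : n * Nat.totient n ≤ gp (Multiplicative (ZMod n)) := by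
  have h := gp_prod_ge n 1 hn one_pos
  have : Unique (ZMod 1) := Unique.mk' _
  have e := gp_congr (AddEquiv.toMultiplicative (AddEquiv.prodUnique (M := ZMod n) (N := ZMod 1)))
  rw [e] at h
  have h1 : 1 ≤ gp (Multiplicative (ZMod 1)) := J_ge 1 one_pos
  nlinarith

theorem J2 : 3 ≤ gp (Multiplicative (ZMod 2)) := J_ge 2 (by norm_num)
theorem J3 : 8 ≤ gp (Multiplicative (ZMod 3)) := J_ge 3 (by norm_num)
theorem J4 : 12 ≤ gp (Multiplicative (ZMod 4)) := J_ge 4 (by norm_num)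
theorem J5 : 24 ≤ gp (Multiplicative (ZMod 5)) := J_ge 5 (by norm_num)
theorem J6 : 24 ≤ gp (Multiplicative (ZMod 6)) := J_ge 6 (by norm_num)
theorem J8 : 48 ≤ gp (Multiplicative (ZMod 8)) := J_ge 8 (by norm_num)
theorem J10 : 72 ≤ gp (Multiplicative (ZMod 10)) := J_ge 10 (by norm_num)
theorem J12 : 96 ≤ gp (Multiplicative (ZMod 12)) := J_ge 12 (by norm_num)

theorem totient_small {n : ℕ} (hn : 0 < n) (h : Nat.totient n ≤ 5) :
    n = 1 ∨ n = 2 ∨ n = 3 ∨ n = 4 ∨ n = 5 ∨ n = 6 ∨ n = 8 ∨ n = 10 ∨ n = 12 := by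
  have hd : n ∣ 120 := by
    rw [Nat.dvd_iff_prime_pow_dvd_dvd]
    intro p k hp hk
    have h1 : Nat.totient (p ^ k) ≤ 5 :=
      (Nat.le_of_dvd (Nat.totient_pos.2 hn) (Nat.totient_dvd_of_dvd hk)).trans h
    rcases k with _ | k
    · simp
    · rw [Nat.totient_prime_pow_succ hp] at h1
      have hp2 := hp.two_le
      have hpk : 1 ≤ p ^ k := Nat.one_le_pow _ _ hp.pos
      have h5 : p ≤ 6 := by
        have : 1 * (p - 1) ≤ p ^ k * (p - 1) := Nat.mul_le_mul_right _ hpk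
        omega
      have hk2 : 2 ^ k ≤ p ^ k := Nat.pow_le_pow_left hp2 k
      have hk3 : k < 3 := by
        by_contra hk
        have : 2 ^ 3 ≤ 2 ^ k := Nat.pow_le_pow_right (by norm_num) (by omega)
        have : p ^ k * 1 ≤ p ^ k * (p - 1) := Nat.mul_le_mul_left _ (by omega)
        omega
      interval_cases p <;> interval_cases k <;> revert h1 hp <;> decide
  have hmem : n ∈ Nat.divisors 120 := Nat.mem_divisors.2 ⟨hd, by norm_num⟩
  have e : Nat.divisors 120 = {1,2,3,4,5,6,8,10,12,15,20,24,30,40,60,120} := by decide +kernel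
  rw [e] at hmem
  simp only [Finset.mem_insert, Finset.mem_singleton] at hmem
  rcases hmem with rfl|rfl|rfl|rfl|rfl|rfl|rfl|rfl|rfl|rfl|rfl|rfl|rfl|rfl|rfl|rfl <;>
    first
      | (simp; done)
      | (exfalso; revert h; decide +kernel)

theorem cyc_of_equiv {A B : Type*} [Group A] [Group B] (e : A ≃* B) [IsCyclic B] : IsCyclic A :=
  isCyclic_of_surjective e.symm e.symm.surjective

theorem ab_class {A : Type u} [CommGroup A] [Finite A] (h2 : ∃ a b : A, Gen a b)
    (hc : ¬ IsCyclic A) (h : gp A < 6 * Nat.card A) :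
    Nonempty (A ≃* Multiplicative (ZMod 2 × ZMod 2)) ∨
    Nonempty (A ≃* Multiplicative (ZMod 4 × ZMod 2)) ∨
    Nonempty (A ≃* Multiplicative (ZMod 3 × ZMod 3)) ∨
    Nonempty (A ≃* Multiplicative (ZMod 6 × ZMod 2)) := by
  obtain ⟨x, y, hxy⟩ := h2
  obtain ⟨a, b, ha, hb, ⟨e⟩⟩ := ab_struct hxy
  have hcop : ¬ Nat.Coprime a b := by
    intro hco
    apply hc
    have : NeZero (a * b) := ⟨(Nat.mul_pos ha hb).ne'⟩
    have e' : A ≃* Multiplicative (ZMod (a * b)) :=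
      e.trans (AddEquiv.toMultiplicative (ZMod.chineseRemainder hco).symm.toAddEquiv)
    exact cyc_of_equiv e'
  have hcard : Nat.card A = a * b := by
    rw [Nat.card_congr e.toEquiv]
    change Nat.card (ZMod a × ZMod b) = _
    rw [Nat.card_prod, Nat.card_zmod, Nat.card_zmod]
  rw [hcard, gp_congr e] at h
  have g1 := gp_prod_ge a b ha hb
  have g2 := gp_prod_ge b a hb ha
  rw [gp_prod_comm] at g2
  have t1 := J_ge_totient b hb
  have hφa : 0 < Nat.totient a := Nat.totient_pos.2 ha
  have hφb : 0 < Nat.totient b := Nat.totient_pos.2 hb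
  have hlt : Nat.totient a * Nat.totient b < 6 := by
    have : (Nat.totient a * Nat.totient b) * (a * b) < 6 * (a * b) := by
      calc (Nat.totient a * Nat.totient b) * (a * b)
          = (b * Nat.totient b) * (a * Nat.totient a) := by ring
        _ ≤ gp (Multiplicative (ZMod b)) * (a * Nat.totient a) := by gcongr
        _ < _ := lt_of_le_of_lt g1 h
    exact lt_of_mul_lt_mul_right this (Nat.zero_le _)
  have ha5 : Nat.totient a ≤ 5 := by nlinarith
  have hb5 : Nat.totient b ≤ 5 := by nlinarith
  have j2 := J2
  have j3 := J3
  have j4 := J4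
  have j5 := J5
  have j6 := J6
  have j8 := J8
  have j10 := J10
  have j12 := J12
  have p1 : Nat.totient 1 = 1 := by decide +kernel
  have p2 : Nat.totient 2 = 1 := by decide +kernel
  have p3 : Nat.totient 3 = 2 := by decide +kernel
  have p4 : Nat.totient 4 = 2 := by decide +kernel
  have p5 : Nat.totient 5 = 4 := by decide +kernel
  have p6 : Nat.totient 6 = 2 := by decide +kernel
  have p8 : Nat.totient 8 = 4 := by decide +kernel
  have p10 : Nat.totient 10 = 4 := by decide +kernel
  have p12 : Nat.totient 12 = 4 := by decide +kernel
  rcases totient_small ha ha5 with rfl|rfl|rfl|rfl|rfl|rfl|rfl|rfl|rfl <;>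
  rcases totient_small hb hb5 with rfl|rfl|rfl|rfl|rfl|rfl|rfl|rfl|rfl
  all_goals first
    | (exfalso; apply hcop; norm_num; done)
    | exact Or.inl ⟨e⟩
    | exact Or.inr (Or.inl ⟨e⟩)
    | exact Or.inr (Or.inl ⟨e.trans (AddEquiv.toMultiplicative AddEquiv.prodComm)⟩)
    | exact Or.inr (Or.inr (Or.inl ⟨e⟩))
    | exact Or.inr (Or.inr (Or.inr ⟨e⟩))
    | exact Or.inr (Or.inr (Or.inr ⟨e.trans (AddEquiv.toMultiplicative AddEquiv.prodComm)⟩))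
    | (exfalso; simp only [p2, p3, p4, p5, p6, p8, p10, p12] at g1 g2 hlt; omega)

theorem card_M (a b : ℕ) : Nat.card (Multiplicative (ZMod a × ZMod b)) = a * b := by
  change Nat.card (ZMod a × ZMod b) = _
  rw [Nat.card_prod, Nat.card_zmod, Nat.card_zmod]

theorem ab_small {A : Type u} [CommGroup A] [Finite A] (h2 : ∃ a b : A, Gen a b)
    (h : gp A < 3 * Nat.card A) :
    Nat.card A = 1 ∨ (Nat.card A = 2 ∧ 3 ≤ gp A) ∨ (Nat.card A = 3 ∧ 8 ≤ gp A) ∨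
    (Nonempty (A ≃* Multiplicative (ZMod 2 × ZMod 2)) ∧ 6 ≤ gp A) := by
  by_cases hc : IsCyclic A
  · have e := zmodCyclicMulEquiv hc
    have hpos : 0 < Nat.card A := Nat.card_pos
    have hg := (gp_congr e).symm
    have t := J_ge_totient _ hpos
    generalize Nat.card A = n at *
    have ht : Nat.totient n < 3 := by
      rw [hg] at h
      nlinarith
    have j4 := J4
    have j5 := J5
    have j6 := J6
    have j8 := J8
    have j10 := J10
    have j12 := J12
    have p8 : Nat.totient 8 = 4 := by decide +kernel
    have p5 : Nat.totient 5 = 4 := by decide +kernel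
    rw [hg] at h ⊢
    rcases totient_small hpos (by omega) with rfl|rfl|rfl|rfl|rfl|rfl|rfl|rfl|rfl
    · exact Or.inl rfl
    · exact Or.inr (Or.inl ⟨rfl, J2⟩)
    · exact Or.inr (Or.inr (Or.inl ⟨rfl, J3⟩))
    all_goals (exfalso; omega)
  · have j2 := J2
    have j3 := J3
    rcases ab_class h2 hc (by omega) with ⟨⟨e⟩⟩ | ⟨⟨e⟩⟩ | ⟨⟨e⟩⟩ | ⟨⟨e⟩⟩
    · refine Or.inr (Or.inr (Or.inr ⟨⟨e⟩, ?_⟩))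
      rw [gp_congr e]
      have := gp_prod_ge 2 2 (by norm_num) (by norm_num)
      have p2 : Nat.totient 2 = 1 := by decide +kernel
      rw [p2] at this
      omega
    · exfalso
      rw [gp_congr e, Nat.card_congr e.toEquiv, card_M] at h
      have := gp_prod_ge 4 2 (by norm_num) (by norm_num)
      have p2 : Nat.totient 4 = 2 := by decide +kernel
      rw [p2] at this
      omega
    · exfalso
      rw [gp_congr e, Nat.card_congr e.toEquiv, card_M] at h
      have := gp_prod_ge 3 3 (by norm_num) (by norm_num)
      have p2 : Nat.totient 3 = 2 := by decide +kernel
      rw [p2] at this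
      omega
    · exfalso
      rw [gp_congr e, Nat.card_congr e.toEquiv, card_M] at h
      have := gp_prod_ge 6 2 (by norm_num) (by norm_num)
      have p2 : Nat.totient 6 = 2 := by decide +kernel
      rw [p2] at this
      omega

end GenPairs

namespace GenPairs
universe u
open scoped commutatorElement
variable {G : Type u} [Group G]

/-- powers of an element of order n indexed by ZMod n -/
theorem exists_pow (r : G) (n : ℕ) (hr : orderOf r = n) : ∃ p : ZMod n → G,
    p 1 = r ∧ p 0 = 1 ∧ (∀ i j, p (i + j) = p i * p j) ∧ (∀ i j, p (i - j) = p i * (p j)⁻¹) ∧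
    Function.Injective p ∧ (∀ i, p i ∈ Subgroup.zpowers r) ∧
    (∀ y : G, y * r * y⁻¹ = r⁻¹ → ∀ i, p i * y = y * (p i)⁻¹) := by
  subst hr
  let F : ZMod (orderOf r) →+ Additive G := ZMod.lift (orderOf r)
    ⟨(zmultiplesHom (Additive G)) (Additive.ofMul r), by
      simp only [zmultiplesHom_apply]
      rw [← ofMul_zpow, zpow_natCast, pow_orderOf_eq_one, ofMul_one]⟩
  have hF : ∀ k : ℤ, Additive.toMul (F (k : ZMod (orderOf r))) = r ^ k := by
    intro k
    simp only [F, ZMod.lift_coe, zmultiplesHom_apply]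
    rfl
  refine ⟨fun i => Additive.toMul (F i), ?_, ?_, ?_, ?_, ?_, ?_, ?_⟩
  · have := hF 1
    simpa using this
  · simp
  · intro i j; simp
  · intro i j; simp [div_eq_mul_inv]
  · intro i j h
    obtain ⟨a, rfl⟩ := ZMod.intCast_surjective i
    obtain ⟨b, rfl⟩ := ZMod.intCast_surjective j
    simp only [hF] at h
    rw [ZMod.intCast_eq_intCast_iff]
    exact zpow_eq_zpow_iff_modEq.1 h
  · intro i
    obtain ⟨a, rfl⟩ := ZMod.intCast_surjective i
    simp only [hF]
    exact Subgroup.zpow_mem_zpowers r a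
  · intro y hy i
    obtain ⟨a, rfl⟩ := ZMod.intCast_surjective i
    simp only [hF]
    have h1 : y * r ^ a * y⁻¹ = (r ^ a)⁻¹ := by
      rw [← conj_zpow, hy, inv_zpow]
    have h2 : y * (r ^ a)⁻¹ * y⁻¹ = r ^ a := by rw [conj_inv3, h1, inv_inv]
    rw [mul_inv_eq_iff_eq_mul] at h2
    exact h2.symm

theorem dihedral_equiv {r y : G} {n : ℕ} (hgen : Gen r y) (hr : orderOf r = n) (hy : y ^ 2 = 1)
    (hry : y * r * y⁻¹ = r⁻¹) (hnot : y ∉ Subgroup.zpowers r) :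
    Nonempty (G ≃* DihedralGroup n) := by
  obtain ⟨p, p1, p0, pa, ps, pinj, pz, pc⟩ := exists_pow r n hr
  have pc := pc y hry
  have hyy : y * y = 1 := by rw [← sq, hy]
  let F : DihedralGroup n → G := fun d => match d with
    | .r i => p i
    | .sr i => y * p i
  have hm : ∀ a b, F (a * b) = F a * F b := by
    have pcm : ∀ i j, p i * p j = p j * p i := fun i j => by rw [← pa, ← pa, add_comm]
    rintro (i | i) (j | j)
    · exact pa i j
    · change y * p (j - i) = p i * (y * p j)
      rw [← mul_assoc, pc, ps, ← ps, sub_eq_neg_add, pa]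
      have : p (-i) = (p i)⁻¹ := by
        have := ps 0 i; simpa [p0] using this
      rw [this, mul_assoc]
    · change y * p (i + j) = y * p i * p j
      rw [pa, mul_assoc]
    · change p (j - i) = y * p i * (y * p j)
      have : y * p i * (y * p j) = y * (p i * y) * p j := by group
      rw [this, pc, ← mul_assoc, hyy, one_mul]
      have : p (-i) = (p i)⁻¹ := by
        have := ps 0 i; simpa [p0] using this
      rw [sub_eq_neg_add, pa, this]
  let f : DihedralGroup n →* G := MonoidHom.mk' F hm
  refine ⟨(MulEquiv.ofBijective f ⟨?_, ?_⟩).symm⟩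
  · rintro (i | i) (j | j) h
    · have : p i = p j := h
      rw [pinj this]
    · exfalso
      have h' : p i = y * p j := h
      apply hnot
      have := Subgroup.mul_mem _ (pz i) (Subgroup.inv_mem _ (pz j))
      rw [h'] at this
      simpa using this
    · exfalso
      have h' : y * p i = p j := h
      apply hnot
      have := Subgroup.mul_mem _ (pz j) (Subgroup.inv_mem _ (pz i))
      rw [← h'] at this
      simpa using this
    · have h' : y * p i = y * p j := h
      rw [pinj (mul_left_cancel h')]
  · rw [← MonoidHom.range_eq_top]
    apply gen_iff.1 hgen
    · exact ⟨.r 1, p1⟩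
    · refine ⟨.sr 0, ?_⟩
      change y * p 0 = y
      rw [p0, mul_one]

theorem quaternion_equiv {r y : G} (hgen : Gen r y) (hr : orderOf r = 4) (hy : y ^ 2 = r ^ 2)
    (hry : y * r * y⁻¹ = r⁻¹) (hnot : y ∉ Subgroup.zpowers r) :
    Nonempty (G ≃* QuaternionGroup 2) := by
  obtain ⟨p, p1, p0, pa, ps, pinj, pz, pc⟩ := exists_pow r (2 * 2) hr
  have pc := pc y hry
  have hyy : y * y = p 2 := by
    have : (2 : ZMod (2 * 2)) = 1 + 1 := by norm_num
    rw [← sq, hy, this, pa, p1, sq]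
  let F : QuaternionGroup 2 → G := fun d => match d with
    | .a i => p i
    | .xa i => y * p i
  have pn : ∀ i, p (-i) = (p i)⁻¹ := by
    intro i
    have := ps 0 i; simpa [p0] using this
  have hm : ∀ a b, F (a * b) = F a * F b := by
    rintro (i | i) (j | j)
    · exact pa i j
    · change y * p (j - i) = p i * (y * p j)
      rw [← mul_assoc, pc, sub_eq_neg_add, pa, pn, mul_assoc]
    · change y * p (i + j) = y * p i * p j
      rw [pa, mul_assoc]
    · change p ((2 : ℕ) + j - i) = y * p i * (y * p j)
      have : y * p i * (y * p j) = y * (p i * y) * p j := by group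
      rw [this, pc, ← mul_assoc, hyy, add_sub_assoc, sub_eq_neg_add, pa, pa, pn, mul_assoc]
      rfl
  let f : QuaternionGroup 2 →* G := MonoidHom.mk' F hm
  refine ⟨(MulEquiv.ofBijective f ⟨?_, ?_⟩).symm⟩
  · rintro (i | i) (j | j) h
    · have : p i = p j := h
      rw [pinj this]
    · exfalso
      have h' : p i = y * p j := h
      apply hnot
      have := Subgroup.mul_mem _ (pz i) (Subgroup.inv_mem _ (pz j))
      rw [h'] at this
      simpa using this
    · exfalso
      have h' : y * p i = p j := h
      apply hnot
      have := Subgroup.mul_mem _ (pz j) (Subgroup.inv_mem _ (pz i))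
      rw [← h'] at this
      simpa using this
    · have h' : y * p i = y * p j := h
      rw [pinj (mul_left_cancel h')]
  · rw [← MonoidHom.range_eq_top]
    apply gen_iff.1 hgen
    · exact ⟨.a 1, p1⟩
    · refine ⟨.xa 0, ?_⟩
      change y * p 0 = y
      rw [p0, mul_one]

end GenPairs

namespace GenPairs
universe u
open scoped commutatorElement
variable {G : Type u} [Group G]

theorem pow_one_of_conj {t x g : G} (h : t * x * t⁻¹ = g) {k : ℕ} (hk : g ^ k = 1) : x ^ k = 1 := by
  rw [← h, conj_pow, conj_eq_one_iff] at hk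
  exact hk

theorem conj_mul_comp (g h x : G) : (g * h) * x * (g * h)⁻¹ = g * (h * x * h⁻¹) * g⁻¹ := by group

theorem conj_mem_iff (K : Subgroup G) [hK : K.Normal] (g x : G) : g * x * g⁻¹ ∈ K ↔ x ∈ K := by
  constructor
  · intro h
    have := hK.conj_mem _ h g⁻¹
    simpa [mul_assoc] using this
  · intro h; exact hK.conj_mem _ h g

theorem c2_conj [Finite G] (K : Subgroup G) [hK : K.Normal] (hi : K.index = 2)
    (h6 : Nat.card (Om G) < 6) {x y u v : G} (hxy : Gen x y) (huv : Gen u v)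
    (hx : x ∉ K) (hy : y ∉ K) (hu : u ∉ K) (hv : v ∉ K) :
    ∃ g, g * x * g⁻¹ = u ∧ g * y * g⁻¹ = v := by
  rw [← cls_eq hxy huv]
  by_contra hne
  have ne1 : cls hxy.left_mul ≠ cls huv.left_mul := by
    intro e
    obtain ⟨g, g1, g2⟩ := (cls_eq _ _).1 e
    apply hne
    rw [cls_eq]
    refine ⟨g, g1, ?_⟩
    rw [conj_mul3, g1] at g2
    exact mul_left_cancel g2
  have ne2 := cls_ne_swap ne1
  have hxyK : x * y ∈ K := (Subgroup.mul_mem_iff_of_index_two hi).2 (by tauto)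
  have huvK : u * v ∈ K := (Subgroup.mul_mem_iff_of_index_two hi).2 (by tauto)
  have key : ∀ {a b c d : G} (h : Gen a b) (k : Gen c d),
      ¬ ((a ∈ K ↔ c ∈ K) ∧ (b ∈ K ↔ d ∈ K)) → cls h ≠ cls k := by
    intro a b c d h k hn e
    apply hn
    obtain ⟨g, g1, g2⟩ := (cls_eq _ _).1 e
    rw [← g1, ← g2, conj_mem_iff, conj_mem_iff]
    exact ⟨Iff.rfl, Iff.rfl⟩
  have := length_le_natCard [cls hxy, cls huv, cls hxy.left_mul, cls huv.left_mul,
    cls hxy.left_mul.swap, cls huv.left_mul.swap] (by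
    simp only [List.nodup_cons, List.mem_cons, List.not_mem_nil, not_or, or_false, not_false_iff,
      List.nodup_nil, and_true]
    refine ⟨⟨?_, ?_, ?_, ?_, ?_⟩, ⟨?_, ?_, ?_, ?_⟩, ⟨?_, ?_, ?_⟩, ⟨?_, ?_⟩, ?_⟩
    all_goals first
      | exact hne
      | exact ne1
      | exact ne2
      | (apply key; tauto))
  simp only [List.length_cons, List.length_nil] at this
  omega

theorem c2_lemma [Finite G] (h2 : ∃ a b : G, Gen a b) (hZ : Subgroup.center G = ⊥)
    (hA : Nat.card (Abelianization G) = 2) (hlt : gp G < 6 * Nat.card G) :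
    Nonempty (G ≃* DihedralGroup 3) := by
  have h6 : Nat.card (Om G) < 6 := by
    rw [gp_eq_Om hZ] at hlt
    exact lt_of_mul_lt_mul_right hlt (Nat.zero_le _)
  obtain ⟨K, hKdef⟩ : ∃ K, K = commutator G := ⟨_, rfl⟩
  have hK : K.Normal := hKdef ▸ inferInstance
  have hi : K.index = 2 := by rw [hKdef]; exact hA
  have hmul : ∀ {a b : G}, a * b ∈ K ↔ (a ∈ K ↔ b ∈ K) := Subgroup.mul_mem_iff_of_index_two hi
  have c1 := fun {x y u v : G} (h : Gen x y) (k : Gen u v) => c2_conj K hi h6 h k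
  have c2 : ∀ {x y u v : G}, Gen x y → Gen u v → x ∉ K → y ∈ K → u ∉ K → v ∈ K →
      ∃ g, g * x * g⁻¹ = u ∧ g * y * g⁻¹ = v := by
    intro x y u v h k hx hy hu hv
    obtain ⟨g, g1, g2⟩ := c1 h.left_mul k.left_mul hx (by rw [hmul]; tauto) hu (by rw [hmul]; tauto)
    refine ⟨g, g1, ?_⟩
    rw [conj_mul3, g1] at g2
    exact mul_left_cancel g2
  obtain ⟨x, y, hxy, hx, hy⟩ : ∃ x y : G, Gen x y ∧ x ∉ K ∧ y ∉ K := by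
    obtain ⟨a, b, hab⟩ := h2
    by_cases ha : a ∈ K
    · by_cases hb : b ∈ K
      · exfalso
        have := gen_iff.1 hab K ha hb
        rw [this, Subgroup.index_top] at hi
        omega
      · exact ⟨b, b * a, hab.swap.left_mul, hb, by rw [hmul]; tauto⟩
    · by_cases hb : b ∈ K
      · exact ⟨a, a * b, hab.left_mul, ha, by rw [hmul]; tauto⟩
      · exact ⟨a, b, hab, ha, hb⟩
  obtain ⟨g, g1, g2⟩ := c1 hxy hxy.swap hx hy hy hx
  have hg2 : g ^ 2 = 1 := by
    apply hxy.eq_one hZ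
    · rw [sq, conj_mul_comp, g1, g2]
    · rw [sq, conj_mul_comp, g2, g1]
  have hgi : g⁻¹ = g := by rw [inv_eq_iff_mul_eq_one, ← sq, hg2]
  have hxg : Gen x g := hxy.mk' fun L hu hv =>
    ⟨hu, g1 ▸ L.mul_mem (L.mul_mem hv hu) (L.inv_mem hv)⟩
  have hx2 : x ^ 2 = 1 := by
    by_cases hg : g ∈ K
    · have hxy' : Gen x y⁻¹ := hxy.mk' fun L hu hv => ⟨hu, by simpa using L.inv_mem hv⟩
      obtain ⟨h, e1, e2⟩ := c1 hxy hxy' hx hy hx (by simpa using hy)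
      obtain ⟨q, hq⟩ : ∃ q, q = g * h := ⟨_, rfl⟩
      have q1 : q * x * q⁻¹ = y := by rw [hq, conj_mul_comp, e1, g1]
      have q2 : q * y * q⁻¹ = x⁻¹ := by rw [hq, conj_mul_comp, e2, conj_inv3, g2]
      have qq : q ^ 2 * x * (q ^ 2)⁻¹ = x⁻¹ := by rw [sq, conj_mul_comp, q1, q2]
      have qy : q ^ 2 * y * (q ^ 2)⁻¹ = y⁻¹ := by
        rw [sq, conj_mul_comp, q2, conj_inv3, q1]
      have q4 : q ^ 4 = 1 := by
        have e : q ^ 4 = q ^ 2 * q ^ 2 := by rw [← pow_add]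
        apply hxy.eq_one hZ
        · rw [e, conj_mul_comp, qq, conj_inv3, qq, inv_inv]
        · rw [e, conj_mul_comp, qy, conj_inv3, qy, inv_inv]
      have hxq : Gen x q := hxy.mk' fun L hu hv =>
        ⟨hu, q1 ▸ L.mul_mem (L.mul_mem hv hu) (L.inv_mem hv)⟩
      by_cases hqK : q ∈ K
      · obtain ⟨t, t1, t2⟩ := c2 hxq hxg hx hqK hx hg
        have hq2 := pow_one_of_conj t2 hg2
        rw [hq2] at qq
        simp only [one_mul, inv_one, mul_one] at qq
        rw [sq]
        exact mul_eq_one_iff_eq_inv.2 qq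
      · obtain ⟨t, t1, t2⟩ := c1 hxq hxq.swap hx hqK hqK hx
        have hx4 : x ^ 4 = 1 := pow_one_of_conj t1 q4
        have hw : Gen x (x ^ 2 * g) := hxg.mk' fun L hu hv => ⟨hu, by
          simpa using L.mul_mem (L.inv_mem (L.pow_mem hu 2)) hv⟩
        obtain ⟨d, d1, d2⟩ := c2 hw hxg hx
          (K.mul_mem (Subgroup.sq_mem_of_index_two hi x) hg) hx hg
        have hw2 := pow_one_of_conj d2 hg2
        have hy2 : y ^ 2 = x ^ 2 := by
          have a1 : x ^ 2 * y ^ 2 = 1 := by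
            rw [← g1, conj_pow, ← hw2, sq (x ^ 2 * g), hgi]; group
          have a2 : x ^ 2 * x ^ 2 = 1 := by rw [← pow_add]; exact hx4
          exact mul_left_cancel (a1.trans a2.symm)
        apply hxy.eq_one hZ
        · group
        · rw [← hy2]; group
    · obtain ⟨t, t1, t2⟩ := c1 hxg hxg.swap hx hg hg hx
      exact pow_one_of_conj t1 hg2
  have hy2 : y ^ 2 = 1 := by rw [← g1, conj_pow, hx2]; simp
  have hxi : x⁻¹ = x := by rw [inv_eq_iff_mul_eq_one, ← sq, hx2]
  have hyi : y⁻¹ = y := by rw [inv_eq_iff_mul_eq_one, ← sq, hy2]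
  obtain ⟨s, hs⟩ : ∃ s, s = x * y := ⟨_, rfl⟩
  have hsi : s⁻¹ = y * x := by rw [hs, mul_inv_rev, hxi, hyi]
  have xs : x * s * x⁻¹ = s⁻¹ := by
    rw [hsi, hs, hxi, ← mul_assoc, ← sq, hx2, one_mul]
  have ys : y * s * y⁻¹ = s⁻¹ := by
    rw [hsi, hs]; group
  have hsK : s ∈ K := by rw [hs, hmul]; tauto
  have hs1 : s ≠ 1 := by
    intro e
    have e' : x = y := by rw [e, eq_comm, mul_eq_one_iff_eq_inv, hyi] at hs; exact hs
    have : y = 1 := hxy.eq_one hZ (by rw [e']; group) (by group)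
    rw [this] at hy
    exact hy K.one_mem
  have hgsy : Gen s y := hxy.mk' fun L hu hv => ⟨by
    have := L.mul_mem hu (L.inv_mem hv)
    simpa [hs] using this, hv⟩
  have hodd : ¬ 2 ∣ orderOf s := by
    rintro ⟨m, hm⟩
    have hpos : 0 < orderOf s := orderOf_pos s
    have h1 : s ^ m = 1 := by
      have hh : (s ^ m)⁻¹ = s ^ m := by
        rw [inv_eq_iff_mul_eq_one, ← pow_add, ← two_mul, ← hm, pow_orderOf_eq_one]
      apply hgsy.eq_one hZ
      · rw [mul_inv_eq_iff_eq_mul, ← pow_succ, pow_succ']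
      · have : y * s ^ m * y⁻¹ = s ^ m := by rw [← conj_pow, ys, inv_pow, hh]
        rw [mul_inv_eq_iff_eq_mul] at this ⊢
        exact this.symm
    have := orderOf_dvd_of_pow_eq_one h1
    have := Nat.le_of_dvd (by omega) this
    omega
  obtain ⟨m, hm⟩ : ∃ m, orderOf s + 1 = 2 * m := ⟨(orderOf s + 1) / 2, by omega⟩
  have hsm : (s ^ 2) ^ m = s := by
    rw [← pow_mul, ← hm, pow_succ, pow_orderOf_eq_one, one_mul]
  have hg3 : Gen y (s ^ 2 * y) := hgsy.mk' fun L hu hv => ⟨by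
    have h1 : s ^ 2 ∈ L := by simpa using L.mul_mem hv (L.inv_mem hu)
    rw [← hsm]; exact L.pow_mem h1 m, hu⟩
  obtain ⟨d, d1, d2⟩ := c1 hxy.swap hg3 hy hx hy (by
    rw [hmul]
    have := K.pow_mem hsK 2
    tauto)
  have ds : d * s * d⁻¹ = s ^ 2 := by
    rw [hs, conj_mul3, d2, d1, ← hs, mul_assoc, ← sq, hy2, mul_one]
  have hall : d * s * d⁻¹ = s ∨ d * s * d⁻¹ = s⁻¹ := by
    let L : Subgroup G :=
      { carrier := {g | g * s * g⁻¹ = s ∨ g * s * g⁻¹ = s⁻¹}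
        one_mem' := by left; simp
        mul_mem' := by
          rintro a b (ha | ha) (hb | hb)
          · left; rw [conj_mul_comp, hb, ha]
          · right; rw [conj_mul_comp, hb, conj_inv3, ha]
          · right; rw [conj_mul_comp, hb, ha]
          · left; rw [conj_mul_comp, hb, conj_inv3, ha, inv_inv]
        inv_mem' := by
          rintro a (ha | ha)
          · left
            calc a⁻¹ * s * a⁻¹⁻¹ = a⁻¹ * (a * s * a⁻¹) * a := by rw [ha]; group
              _ = s := by group
          · right
            calc a⁻¹ * s * a⁻¹⁻¹ = a⁻¹ * (a * s * a⁻¹)⁻¹ * a := by rw [ha]; group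
              _ = s⁻¹ := by group }
    have : L = ⊤ := gen_iff.1 hxy L (Or.inr xs) (Or.inr ys)
    have hd : d ∈ L := this ▸ Subgroup.mem_top d
    exact hd
  have hs3 : s ^ 3 = 1 := by
    rw [ds] at hall
    rcases hall with e | e
    · exfalso
      apply hs1
      rw [sq] at e
      simpa using e
    · rw [pow_succ, e]; group
  have hp3 : Fact (Nat.Prime 3) := ⟨by norm_num⟩
  exact dihedral_equiv hgsy (orderOf_eq_prime hs3 hs1) hy2 ys (by
    intro h
    apply hy
    have : Subgroup.zpowers s ≤ K := by rw [Subgroup.zpowers_le]; exact hsK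
    exact this h)

end GenPairs

namespace GenPairs
universe u
open scoped commutatorElement
variable {G : Type u} [Group G]

theorem eq_of_card_two [Finite G] {C : Subgroup G} (h : Nat.card C = 2) {a b : G} (ha : a ∈ C)
    (hb : b ∈ C) (ha1 : a ≠ 1) (hb1 : b ≠ 1) : a = b := by
  by_contra hab
  have := length_le_natCard [(1 : C), ⟨a, ha⟩, ⟨b, hb⟩] (by
    simp only [List.nodup_cons, List.mem_cons, List.not_mem_nil, not_or, or_false, not_false_iff,
      List.nodup_nil, and_true]
    refine ⟨⟨?_, ?_⟩, ?_⟩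
    · intro e; exact ha1 (congrArg Subtype.val e).symm
    · intro e; exact hb1 (congrArg Subtype.val e).symm
    · intro e; exact hab (congrArg Subtype.val e))
  simp only [List.length_cons, List.length_nil] at this
  omega

theorem pow_card_sub [Finite G] {C : Subgroup G} {a : G} (ha : a ∈ C) : a ^ Nat.card C = 1 := by
  have := pow_card_eq_one' (x := (⟨a, ha⟩ : C))
  exact congrArg Subtype.val this

theorem eq_of_card_three [Finite G] {C : Subgroup G} (h : Nat.card C = 3) {s w : G} (hs : s ∈ C)
    (hs1 : s ≠ 1) (hw : w ∈ C) : w = 1 ∨ w = s ∨ w = s⁻¹ := by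
  by_contra hcon
  push Not at hcon
  obtain ⟨w1, w2, w3⟩ := hcon
  have hs3 : s ^ 3 = 1 := h ▸ pow_card_sub hs
  have hsi : s ≠ s⁻¹ := by
    intro e
    apply hs1
    have h2 : s * s = 1 := mul_eq_one_iff_eq_inv.2 e
    have : s ^ 3 = s * s * s := by simp only [pow_succ, pow_zero, one_mul]
    rw [this, h2, one_mul] at hs3
    exact hs3
  have := length_le_natCard [(1 : C), ⟨s, hs⟩, ⟨s⁻¹, C.inv_mem hs⟩, ⟨w, hw⟩] (by
    simp only [List.nodup_cons, List.mem_cons, List.not_mem_nil, not_or, or_false, not_false_iff,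
      List.nodup_nil, and_true]
    refine ⟨⟨?_, ?_, ?_⟩, ⟨?_, ?_⟩, ?_⟩
    · intro e; exact hs1 (congrArg Subtype.val e).symm
    · intro e; exact hs1 (inv_eq_one.1 (congrArg Subtype.val e).symm)
    · intro e; exact w1 (congrArg Subtype.val e).symm
    · intro e; exact hsi (congrArg Subtype.val e)
    · intro e; exact w2 (congrArg Subtype.val e).symm
    · intro e; exact w3 (congrArg Subtype.val e).symm)
  simp only [List.length_cons, List.length_nil] at this
  omega

theorem perfect_all_aux (n : ℕ) : ∀ (G : Type u) [Group G] [Finite G] [Nontrivial G],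
    Nat.card G = n → (∃ a b : G, Gen a b) → commutator G = ⊤ → 6 * Nat.card G ≤ gp G := by
  induction n using Nat.strong_induction_on with
  | _ n ih =>
  intro G _ _ _ hn h2 hp
  by_cases h0 : Z0 G = ⊥
  · have hZ : Subgroup.center G = ⊥ := by
      have : Z0 G = Subgroup.center G := by rw [Z0, hp, inf_top_eq]
      rw [← this, h0]
    exact perfect hp hZ h2
  · obtain ⟨q1, q2, -⟩ := Z0_quot h2
    have hN := two_le_of_ne_bot h0
    have hs := QuotientGroup.mk'_surjective (Z0 G)
    have hp' : commutator (G ⧸ Z0 G) = ⊤ := by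
      have h := comm_map _ hs
      rw [← h, eq_top_iff]
      intro q _
      obtain ⟨x, rfl⟩ := hs q
      have hx : x ∈ commutator G := hp ▸ Subgroup.mem_top x
      exact ⟨x, hx, rfl⟩
    have hnt : Nontrivial (G ⧸ Z0 G) := by
      rw [← not_subsingleton_iff_nontrivial, QuotientGroup.subsingleton_iff]
      intro e
      have : commutator G = ⊥ := by
        rw [comm_bot_iff]
        intro a b
        have hb : b ∈ Z0 G := e ▸ Subgroup.mem_top b
        exact (Subgroup.mem_center_iff.1 hb.1) a
      rw [this] at hp
      exact bot_ne_top hp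
    have hpos : 0 < Nat.card (G ⧸ Z0 G) := Nat.card_pos
    have := ih _ (by rw [← hn, q2]; nlinarith) (G ⧸ Z0 G) rfl (gen_quot _ hs h2) hp'
    rw [q1, q2]
    calc _ = (6 * Nat.card (G ⧸ Z0 G)) * Nat.card (Z0 G) := by ring
      _ ≤ gp (G ⧸ Z0 G) * Nat.card (Z0 G) := by gcongr
      _ ≤ gp (G ⧸ Z0 G) * (Nat.card (Z0 G)) ^ 2 := by gcongr; nlinarith

theorem comm_le_Z0 (h : commutator (G ⧸ Z0 G) = ⊥) : commutator G ≤ Z0 G := by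
  rw [← comm_map _ (QuotientGroup.mk'_surjective (Z0 G)), Subgroup.map_eq_bot_iff,
    QuotientGroup.ker_mk'] at h
  exact h

theorem quot_nonab [IsCyclic (Abelianization G)] (hn : commutator G ≠ ⊥) :
    commutator (G ⧸ Z0 G) ≠ ⊥ := by
  intro h
  apply hn
  rw [comm_bot_iff]
  exact commutative_of_cyclic_center_quotient (Abelianization.of : G →* Abelianization G) (by
    rw [of_ker]; exact (comm_le_Z0 h).trans inf_le_left)

/-- lower bound when the centre meets the commutator -/
theorem Z0_bound [Finite G] (h2 : ∃ a b : G, Gen a b) (h0 : Z0 G ≠ ⊥)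
    (hq : commutator (G ⧸ Z0 G) ≠ ⊥)
    (hA : 3 * Nat.card (Abelianization G) ≤ 2 * gp (Abelianization G)) :
    6 * Nat.card G ≤ gp G := by
  obtain ⟨q1, q2, ⟨e⟩⟩ := Z0_quot h2
  have hN := two_le_of_ne_bot h0
  have hs := QuotientGroup.mk'_surjective (Z0 G)
  have hE := E1 (gen_quot _ hs h2) hq
  rw [← gp_congr e, ← Nat.card_congr e.toEquiv] at hE
  have hpos : 0 < Nat.card (Abelianization G) := Nat.card_pos
  have h3 : 3 * Nat.card (G ⧸ Z0 G) ≤ gp (G ⧸ Z0 G) := by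
    have : (3 * Nat.card (G ⧸ Z0 G)) * Nat.card (Abelianization G) ≤
        gp (G ⧸ Z0 G) * Nat.card (Abelianization G) := by
      refine le_trans ?_ hE
      calc _ = (3 * Nat.card (Abelianization G)) * Nat.card (G ⧸ Z0 G) := by ring
        _ ≤ _ := by gcongr
    exact le_of_mul_le_mul_right this hpos
  rw [q1, q2]
  calc _ = (3 * Nat.card (G ⧸ Z0 G)) * (2 * Nat.card (Z0 G)) := by ring
    _ ≤ gp (G ⧸ Z0 G) * (Nat.card (Z0 G) * Nat.card (Z0 G)) := by gcongr
    _ = _ := by ring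

theorem order8 [Finite G] (h2 : ∃ a b : G, Gen a b) (hn : commutator G ≠ ⊥)
    (hc : Nat.card (commutator G) = 2) (hsq : ∀ x : G, x ^ 2 ∈ commutator G) :
    Nonempty (G ≃* DihedralGroup 4) ∨ Nonempty (G ≃* QuaternionGroup 2) := by
  obtain ⟨r, y, hry, hr2, hne⟩ : ∃ r y : G, Gen r y ∧ r ^ 2 ≠ 1 ∧ r * y ≠ y * r := by
    obtain ⟨a, b, hab⟩ := h2
    have hne : a * b ≠ b * a := by
      intro e
      apply hn
      rw [comm_bot_iff]
      have ha : a ∈ Subgroup.center G := hab.central rfl e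
      have hb : b ∈ Subgroup.center G := hab.central e.symm rfl
      have := gen_iff.1 hab _ ha hb
      intro u v
      have hv : v ∈ Subgroup.center G := this ▸ Subgroup.mem_top v
      exact (Subgroup.mem_center_iff.1 hv) u
    by_cases ha : a ^ 2 = 1
    · by_cases hb : b ^ 2 = 1
      · refine ⟨a * b, b, hab.swap.right_mul.swap, ?_, ?_⟩
        · intro e
          apply hne
          have hai : a⁻¹ = a := by rw [inv_eq_iff_mul_eq_one, ← sq, ha]
          have hbi : b⁻¹ = b := by rw [inv_eq_iff_mul_eq_one, ← sq, hb]
          have : (a * b)⁻¹ = a * b := by rw [inv_eq_iff_mul_eq_one, ← sq, e]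
          rw [← this, mul_inv_rev, hai, hbi]
        · intro e
          apply hne
          rw [← mul_assoc] at e
          exact mul_right_cancel e
      · exact ⟨b, a, hab.swap, hb, hne.symm⟩
    · exact ⟨a, b, hab, ha, hne⟩
  have hr4 : r ^ 4 = 1 := by
    have := pow_card_sub (hsq r)
    rw [hc, ← pow_mul] at this
    exact this
  have hp2 : Fact (Nat.Prime 2) := ⟨by norm_num⟩
  have ho : orderOf r = 4 := orderOf_eq_prime_pow (p := 2) (n := 1) (by simpa using hr2) hr4
  have hcm : ⁅y, r⁆ ∈ commutator G :=
    Subgroup.commutator_mem_commutator (Subgroup.mem_top y) (Subgroup.mem_top r)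
  have hcm1 : ⁅y, r⁆ ≠ 1 := by
    rw [Ne, commutatorElement_eq_one_iff_mul_comm]
    exact fun e => hne e.symm
  have hceq : ⁅y, r⁆ = r ^ 2 := eq_of_card_two hc hcm (hsq r) hcm1 hr2
  have hyr : y * r * y⁻¹ = r⁻¹ := by
    have h1 : y * r * y⁻¹ = ⁅y, r⁆ * r := by rw [commutatorElement_def]; group
    rw [h1, hceq, eq_inv_iff_mul_eq_one, ← hr4]
    simp only [pow_succ, pow_zero, one_mul, mul_assoc]
  have hnot : y ∉ Subgroup.zpowers r := by
    rintro ⟨k, rfl⟩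
    apply hne
    exact ((Commute.refl r).zpow_right k).eq
  by_cases hy : y ^ 2 = 1
  · exact Or.inl (dihedral_equiv hry ho hy hyr hnot)
  · exact Or.inr (quaternion_equiv hry ho (eq_of_card_two hc (hsq y) (hsq r) hy hr2) hyr hnot)

theorem order12 [Finite G] (h0 : Z0 G = ⊥) (hG : Nat.card G = 12)
    (hc : Nat.card (commutator G) = 3) (hsq : ∀ x : G, x ^ 2 ∈ commutator G)
    (hZ : Nat.card (Subgroup.center G) = 2) :
    Nonempty (G ≃* DihedralGroup 6) := by
  have hcb : commutator G ≠ ⊥ := by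
    intro e; rw [e] at hc; simp at hc
  have hzb : Subgroup.center G ≠ ⊥ := by
    intro e; rw [e] at hZ; simp at hZ
  obtain ⟨s, hs, hs1⟩ := (Subgroup.ne_bot_iff_exists_ne_one.1 hcb) |>.elim
    (fun s hs => (⟨s.1, s.2, fun e => hs (Subtype.ext e)⟩ : ∃ s : G, s ∈ commutator G ∧ s ≠ 1))
  obtain ⟨z, hz, hz1⟩ := (Subgroup.ne_bot_iff_exists_ne_one.1 hzb) |>.elim
    (fun s hs => (⟨s.1, s.2, fun e => hs (Subtype.ext e)⟩ : ∃ s : G, s ∈ Subgroup.center G ∧ s ≠ 1))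
  have hs3 : s ^ 3 = 1 := hc ▸ pow_card_sub hs
  have hz2 : z ^ 2 = 1 := hZ ▸ pow_card_sub hz
  have hp2 : Fact (Nat.Prime 2) := ⟨by norm_num⟩
  have hp3 : Fact (Nat.Prime 3) := ⟨by norm_num⟩
  have os : orderOf s = 3 := orderOf_eq_prime hs3 hs1
  have oz : orderOf z = 2 := orderOf_eq_prime hz2 hz1
  have hzc : ∀ g, g * z = z * g := Subgroup.mem_center_iff.1 hz
  have hsz : Commute s z := hzc s
  have orr : orderOf (s * z) = 6 := by
    rw [hsz.orderOf_mul_eq_mul_orderOf_of_coprime (by rw [os, oz]; norm_num), os, oz]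
  obtain ⟨y, hy⟩ : ∃ y, y * s ≠ s * y := by
    by_contra hcon
    push Not at hcon
    have : s ∈ Z0 G := ⟨Subgroup.mem_center_iff.2 hcon, hs⟩
    rw [h0, Subgroup.mem_bot] at this
    exact hs1 this
  have hys : y * s * y⁻¹ = s⁻¹ := by
    have hm : y * s * y⁻¹ ∈ commutator G := (conj_mem_iff _ _ _).2 hs
    rcases eq_of_card_three hc hs hs1 hm with e | e | e
    · rw [conj_eq_one_iff] at e; exact absurd e hs1
    · rw [mul_inv_eq_iff_eq_mul] at e; exact absurd e hy
    · exact e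
  have hy2 : y ^ 2 = 1 := by
    have hcy : Commute y (y ^ 2) := (Commute.refl y).pow_right 2
    rcases eq_of_card_three hc hs hs1 (hsq y) with e | e | e
    · exact e
    · rw [e] at hcy; exact absurd hcy.eq hy
    · rw [e] at hcy
      have := hcy.inv_right
      rw [inv_inv] at this
      exact absurd this.eq hy
  have hzi : z⁻¹ = z := by rw [inv_eq_iff_mul_eq_one, ← sq, hz2]
  have hyr : y * (s * z) * y⁻¹ = (s * z)⁻¹ := by
    rw [conj_mul3, hys, mul_inv_rev, hzi, hzc y, mul_inv_cancel_right, hzc]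
  have hnot : y ∉ Subgroup.zpowers (s * z) := by
    rintro ⟨k, hk⟩
    apply hy
    have h1 : Commute s (s * z) := (Commute.refl s).mul_right hsz
    have := h1.zpow_right k
    simp only at hk
    rw [hk] at this
    exact this.eq.symm
  refine dihedral_equiv ?_ orr hy2 hyr hnot
  rw [gen_iff]
  intro L hr hyL
  have hle : Subgroup.zpowers (s * z) ≤ L := by rw [Subgroup.zpowers_le]; exact hr
  have hd1 : 6 ∣ Nat.card L := by
    have := Subgroup.card_dvd_of_le hle
    rwa [Nat.card_zpowers, orr] at this
  have hd2 : Nat.card L ∣ 12 := hG ▸ Subgroup.card_subgroup_dvd_card L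
  apply Subgroup.eq_top_of_card_eq
  rw [hG]
  obtain ⟨k, hk⟩ := hd1
  have hle12 := Nat.le_of_dvd (by norm_num) hd2
  have hpos : 0 < Nat.card L := Nat.card_pos
  have : k = 1 ∨ k = 2 := by omega
  rcases this with rfl | rfl
  · exfalso
    apply hnot
    have : Subgroup.zpowers (s * z) = L :=
      Subgroup.eq_of_le_of_card_ge hle (by rw [Nat.card_zpowers, orr, hk])
    rw [this]; exact hyL
  · exact hk

end GenPairs

namespace GenPairs
universe u
open scoped commutatorElement
variable {G : Type u} [Group G]

theorem of_eq_one_iff {g : G} : Abelianization.of g = 1 ↔ g ∈ commutator G := by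
  rw [← MonoidHom.mem_ker, of_ker]

theorem mem_of_of_eq {L : Subgroup G} (hL : commutator G ≤ L) {u z : G} (hu : u ∈ L)
    (h : Abelianization.of u = Abelianization.of z) : z ∈ L := by
  have h1 : u⁻¹ * z ∈ commutator G := by
    rw [← of_eq_one_iff, map_mul, map_inv, h, inv_mul_cancel]
  have := L.mul_mem hu (hL h1)
  simpa using this

theorem comm_le_twist {x y s t : G} (h : Gen x y) (hs : s ∈ Subgroup.center G)
    (ht : t ∈ Subgroup.center G) {L : Subgroup G} (h1 : x * s ∈ L) (h2 : y * t ∈ L) :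
    commutator G ≤ L := by
  apply comm_le_of_sup_center
  apply gen_iff.1 h
  · have := (L ⊔ Subgroup.center G).mul_mem (Subgroup.mem_sup_left h1)
      (Subgroup.mem_sup_right ((Subgroup.center G).inv_mem hs))
    simpa using this
  · have := (L ⊔ Subgroup.center G).mul_mem (Subgroup.mem_sup_left h2)
      (Subgroup.mem_sup_right ((Subgroup.center G).inv_mem ht))
    simpa using this

theorem zpow_two_cases {A : Type*} [Group A] (hA : ∀ a : A, a ^ 2 = 1) (a : A) (m : ℤ) :
    a ^ m = 1 ∨ a ^ m = a := by
  rcases Int.even_or_odd' m with ⟨k, rfl | rfl⟩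
  · left
    rw [zpow_mul, zpow_ofNat, hA, one_zpow]
  · right
    rw [zpow_add, zpow_mul, zpow_ofNat, hA, one_zpow, one_mul, zpow_one]

theorem two_lifts [Finite G] {x y z : G} (h : Gen x y) (hz : z ∈ Subgroup.center G)
    (hzK : z ∉ commutator G) (hA : ∀ a : Abelianization G, a ^ 2 = 1) :
    2 ≤ lifts (QuotientGroup.mk' (Subgroup.center G)) (QuotientGroup.mk' _ x)
      (QuotientGroup.mk' _ y) := by
  have hz1 : z ≠ 1 := by rintro rfl; exact hzK (one_mem _)
  obtain ⟨s, t, hs, ht, hne, hg⟩ : ∃ s t : G, s ∈ Subgroup.center G ∧ t ∈ Subgroup.center G ∧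
      (s ≠ 1 ∨ t ≠ 1) ∧ Gen (x * s) (y * t) := by
    have hm : Abelianization.of z ∈ Subgroup.closure {Abelianization.of x, Abelianization.of y} := by
      have : Gen (Abelianization.of x) (Abelianization.of y) := h.map of_surj
      unfold Gen at this
      rw [this]; trivial
    rw [Subgroup.mem_closure_pair] at hm
    obtain ⟨m, n, hmn⟩ := hm
    have hc := (Subgroup.center G).one_mem
    rcases zpow_two_cases hA (Abelianization.of x) m with e1 | e1 <;>
    rcases zpow_two_cases hA (Abelianization.of y) n with e2 | e2 <;> rw [e1, e2] at hmn
    · exact absurd (of_eq_one_iff.1 (by rw [← hmn, one_mul])) hzK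
    · refine ⟨z, 1, hz, hc, Or.inl hz1, h.mk' fun L h1 h2 => ?_⟩
      have hL := comm_le_twist h hz hc h1 h2
      rw [mul_one] at h2
      rw [one_mul] at hmn
      have hzL : z ∈ L := mem_of_of_eq hL h2 hmn
      exact ⟨(L.mul_mem_cancel_right hzL).1 h1, h2⟩
    · refine ⟨1, z, hc, hz, Or.inr hz1, h.mk' fun L h1 h2 => ?_⟩
      have hL := comm_le_twist h hc hz h1 h2
      rw [mul_one] at h1
      rw [mul_one] at hmn
      have hzL : z ∈ L := mem_of_of_eq hL h1 hmn
      exact ⟨h1, (L.mul_mem_cancel_right hzL).1 h2⟩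
    · refine ⟨z, z, hz, hz, Or.inr hz1, h.mk' fun L h1 h2 => ?_⟩
      have hL := comm_le_twist h hz hz h1 h2
      have hzL : z ∈ L := by
        refine mem_of_of_eq hL (L.mul_mem h1 h2) ?_
        rw [map_mul, map_mul, map_mul, mul_mul_mul_comm, hmn, ← pow_two, hA, mul_one]
      exact ⟨(L.mul_mem_cancel_right hzL).1 h1, (L.mul_mem_cancel_right hzL).1 h2⟩
  unfold lifts
  have e : ∀ {a b : G}, b ∈ Subgroup.center G → QuotientGroup.mk' (Subgroup.center G) (a * b) =
      QuotientGroup.mk' (Subgroup.center G) a := by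
    intro a b hb
    rw [map_mul, (QuotientGroup.eq_one_iff b).2 hb |> fun h => (h : QuotientGroup.mk' (Subgroup.center G) b = 1), mul_one]
  have := length_le_natCard [(⟨(x, y), h, rfl, rfl⟩ : {p : G × G // Gen p.1 p.2 ∧
      QuotientGroup.mk' (Subgroup.center G) p.1 = QuotientGroup.mk' _ x ∧
      QuotientGroup.mk' (Subgroup.center G) p.2 = QuotientGroup.mk' _ y}),
      ⟨(x * s, y * t), hg, e hs, e ht⟩] (by
    simp only [List.nodup_cons, List.mem_cons, List.not_mem_nil, or_false, not_false_eq_true,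
      List.nodup_nil, and_true, Subtype.mk.injEq, Prod.mk.injEq]
    rintro ⟨h1, h2⟩
    rcases hne with h3 | h3
    · exact h3 (by simpa using h1.symm)
    · exact h3 (by simpa using h2.symm))
  exact this

theorem card_mul_comm [Finite G] :
    Nat.card G = Nat.card (Abelianization G) * Nat.card (commutator G) :=
  Subgroup.card_eq_card_quotient_mul_card_subgroup _

theorem klein_Z0_ne [Finite G] (h2 : ∃ a b : G, Gen a b) (hn : commutator G ≠ ⊥)
    (hlt : gp G < 6 * Nat.card G) (h0 : Z0 G ≠ ⊥) (c4 : Nat.card (Abelianization G) = 4)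
    (hsq : ∀ x : G, x ^ 2 ∈ commutator G) (g6 : 6 ≤ gp (Abelianization G)) :
    Nonempty (G ≃* DihedralGroup 4) ∨ Nonempty (G ≃* QuaternionGroup 2) := by
  by_cases hq : commutator (G ⧸ Z0 G) = ⊥
  · obtain ⟨q1, q2, ⟨e⟩⟩ := Z0_quot h2
    obtain ⟨e'⟩ := ab_self hq
    have hE : commutator G = Z0 G := le_antisymm (comm_le_Z0 hq) inf_le_right
    have k1 : gp (G ⧸ Z0 G) = gp (Abelianization G) := gp_congr (e'.trans e.symm)
    have k2 : Nat.card (G ⧸ Z0 G) = Nat.card (Abelianization G) :=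
      Nat.card_congr (e'.trans e.symm).toEquiv
    have hN := two_le_of_ne_bot h0
    rw [k1] at q1
    rw [k2, c4] at q2
    rw [q1, q2] at hlt
    have hN4 : Nat.card (Z0 G) < 4 := by
      by_contra hcon
      push Not at hcon
      nlinarith
    have hN3 : Nat.card (Z0 G) ≠ 3 := by
      intro h3
      apply hn
      rw [comm_bot_iff]
      intro a b
      have hle : ∀ {w : G}, w ∈ commutator G → w ∈ Subgroup.center G := fun hw => (hE ▸ hw : _ ∈ Z0 G).1
      have hc : ⁅a, b⁆ ∈ commutator G :=
        Subgroup.commutator_mem_commutator (Subgroup.mem_top a) (Subgroup.mem_top b)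
      have hcz := Subgroup.mem_center_iff.1 (hle hc)
      have haz := Subgroup.mem_center_iff.1 (hle (hsq a)) b
      have hc3 : ⁅a, b⁆ ^ 3 = 1 := by
        have := pow_card_sub (C := Z0 G) (hE ▸ hc : ⁅a, b⁆ ∈ Z0 G)
        rwa [h3] at this
      have hab : a * b = ⁅a, b⁆ * b * a := by simp [commutatorElement_def]
      generalize ⁅a, b⁆ = c at *
      have : c ^ 2 = 1 := by
        have e1 : a ^ 2 * b = c ^ 2 * (b * a ^ 2) := by
          calc a ^ 2 * b = a * (a * b) := by rw [pow_two, mul_assoc]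
            _ = a * (c * b * a) := by rw [hab]
            _ = (a * c) * (b * a) := by group
            _ = (c * a) * (b * a) := by rw [hcz]
            _ = c * (a * b) * a := by group
            _ = c * (c * b * a) * a := by rw [hab]
            _ = _ := by simp only [pow_two, mul_assoc]
        rw [haz] at e1
        simpa using e1
      have hc1 : c = 1 := by
        rw [pow_succ, this, one_mul] at hc3
        exact hc3
      rw [hab, hc1, one_mul]
    exact order8 h2 hn (by rw [hE]; omega) hsq
  · exact absurd (Z0_bound h2 h0 hq (by omega)) (by omega)

theorem klein_Z0_eq [Finite G] (h2 : ∃ a b : G, Gen a b) (hn : commutator G ≠ ⊥)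
    (hlt : gp G < 6 * Nat.card G) (h0 : Z0 G = ⊥) (c4 : Nat.card (Abelianization G) = 4)
    (hA : ∀ a : Abelianization G, a ^ 2 = 1)
    (hsq : ∀ x : G, x ^ 2 ∈ commutator G) (g6 : 6 ≤ gp (Abelianization G)) :
    Nonempty (G ≃* DihedralGroup 6) := by
  have hGpos : 0 < Nat.card G := Nat.card_pos
  have hd := Z_dvd h0
  have hle : Nat.card (Subgroup.center G) ≤ 4 := by
    rw [c4] at hd; exact Nat.le_of_dvd (by norm_num) hd
  have hz := gp_Z h2
  have hZ2 : Nat.card (Subgroup.center G) = 2 := by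
    rw [c4] at hd
    have n1 : Nat.card (Subgroup.center G) ≠ 1 := by
      intro h1
      rw [h1] at hz
      nlinarith
    have n4 : Nat.card (Subgroup.center G) ≠ 4 := by
      intro h1
      have := m_one h2 hn h0 (by rw [h1, c4])
      rw [c4] at this
      nlinarith
    interval_cases Nat.card (Subgroup.center G) <;> omega
  have hs := QuotientGroup.mk'_surjective (Subgroup.center G)
  have hcG := card_mul_comm (G := G)
  have hcH := card_mul_comm (G := G ⧸ Subgroup.center G)
  have hGH := Subgroup.card_eq_card_quotient_mul_card_subgroup (Subgroup.center G)
  have hck : Nat.card (commutator (G ⧸ Subgroup.center G)) = Nat.card (commutator G) := by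
    have e := comm_map _ hs
    rw [← e]
    refine (Nat.card_congr (Equiv.ofBijective
      ((QuotientGroup.mk' (Subgroup.center G)).subgroupMap (commutator G)) ⟨?_, ?_⟩)).symm
    · rw [injective_iff_map_eq_one]
      intro k hk
      have hk1 : QuotientGroup.mk' (Subgroup.center G) k.1 = 1 := congrArg Subtype.val hk
      have hk2 : k.1 ∈ Subgroup.center G := (QuotientGroup.eq_one_iff _).1 hk1
      have hk3 : k.1 ∈ Z0 G := ⟨hk2, k.2⟩
      rw [h0, Subgroup.mem_bot] at hk3
      exact Subtype.ext hk3
    · exact (QuotientGroup.mk' (Subgroup.center G)).subgroupMap_surjective (commutator G)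
  have hKpos : 0 < Nat.card (commutator G) := Nat.card_pos
  have hAH : Nat.card (Abelianization (G ⧸ Subgroup.center G)) = 2 := by
    rw [hck] at hcH
    rw [hZ2, hcH, hcG, c4] at hGH
    nlinarith
  obtain ⟨z, hzZ, hz1⟩ : ∃ z ∈ Subgroup.center G, z ≠ 1 := by
    by_contra hcon
    push Not at hcon
    rw [(Subgroup.eq_bot_iff_forall _).2 hcon, Subgroup.card_bot] at hZ2
    omega
  have hzK : z ∉ commutator G := by
    intro hk
    have hk3 : z ∈ Z0 G := ⟨hzZ, hk⟩
    rw [h0, Subgroup.mem_bot] at hk3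
    exact hz1 hk3
  have hHlt : gp (G ⧸ Subgroup.center G) < 6 * Nat.card (G ⧸ Subgroup.center G) := by
    obtain ⟨x, y, hxy⟩ := h2
    have hl := two_lifts hxy hzZ hzK hA
    rw [gp_eq_lifts _ hs (hxy.map hs), hGH, hZ2] at hlt
    nlinarith
  obtain ⟨e⟩ := c2_lemma (gen_quot _ hs h2) (center_quot h0) hAH hHlt
  have hH6 : Nat.card (G ⧸ Subgroup.center G) = 6 := by
    rw [Nat.card_congr e.toEquiv, DihedralGroup.nat_card]
  rw [hH6, hZ2] at hGH
  exact order12 h0 hGH (by rw [hGH, c4] at hcG; omega) hsq hZ2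

theorem nonab [Finite G] (h2 : ∃ a b : G, Gen a b) (hn : commutator G ≠ ⊥)
    (hlt : gp G < 6 * Nat.card G) :
    Nonempty (G ≃* DihedralGroup 3) ∨ Nonempty (G ≃* DihedralGroup 4) ∨
    Nonempty (G ≃* QuaternionGroup 2) ∨ Nonempty (G ≃* DihedralGroup 6) := by
  have hGpos : 0 < Nat.card G := Nat.card_pos
  have hApos : 0 < Nat.card (Abelianization G) := Nat.card_pos
  have hE := E1 h2 hn
  have hA3 : gp (Abelianization G) < 3 * Nat.card (Abelianization G) := by
    by_contra hcon
    push Not at hcon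
    have h1 := Nat.mul_le_mul_right (Nat.card G) (Nat.mul_le_mul_left 2 hcon)
    have h2 := Nat.mul_lt_mul_of_pos_right hlt hApos
    nlinarith
  have hcyc : Nat.card (Abelianization G) = 2 ∨ Nat.card (Abelianization G) = 3 →
      IsCyclic (Abelianization G) := by
    rintro (h | h)
    · haveI : Fact (Nat.Prime 2) := ⟨Nat.prime_two⟩
      exact isCyclic_of_prime_card h
    · haveI : Fact (Nat.Prime 3) := ⟨Nat.prime_three⟩
      exact isCyclic_of_prime_card h
  rcases ab_small (gen_quot _ of_surj h2) hA3 with h1 | ⟨h1, g⟩ | ⟨h1, g⟩ | ⟨⟨e⟩, g⟩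
  · exfalso
    have hp : commutator G = ⊤ := Subgroup.index_eq_one.1 h1
    have hnt : Nontrivial G := by
      by_contra hcon
      rw [not_nontrivial_iff_subsingleton] at hcon
      exact hn (Subsingleton.elim _ _)
    have := perfect_all_aux _ G rfl h2 hp
    omega
  · have := hcyc (Or.inl h1)
    by_cases h0 : Z0 G = ⊥
    · have hd := Z_dvd h0
      rw [h1] at hd
      rcases (Nat.dvd_prime Nat.prime_two).1 hd with hc | hc
      · left
        exact c2_lemma h2 (Subgroup.card_eq_one.1 hc) h1 hlt
      · have := m_one h2 hn h0 (by rw [hc, h1])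
        rw [h1] at this
        nlinarith
    · exact absurd (Z0_bound h2 h0 (quot_nonab hn) (by omega)) (by omega)
  · have := hcyc (Or.inr h1)
    by_cases h0 : Z0 G = ⊥
    · have hd := Z_dvd h0
      rw [h1] at hd
      rcases (Nat.dvd_prime Nat.prime_three).1 hd with hc | hc
      · have := gp_Z h2
        rw [hc] at this
        nlinarith
      · have := m_one h2 hn h0 (by rw [hc, h1])
        rw [h1] at this
        nlinarith
    · exact absurd (Z0_bound h2 h0 (quot_nonab hn) (by omega)) (by omega)
  · have c4 : Nat.card (Abelianization G) = 4 := by rw [Nat.card_congr e.toEquiv, card_M]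
    have hA : ∀ a : Abelianization G, a ^ 2 = 1 := by
      intro a
      apply e.injective
      rw [map_pow, map_one]
      generalize e a = w
      revert w
      change ∀ w : ZMod 2 × ZMod 2, 2 • w = 0
      decide
    have hsq : ∀ x : G, x ^ 2 ∈ commutator G := by
      intro x
      rw [← of_eq_one_iff, map_pow, hA]
    by_cases h0 : Z0 G = ⊥
    · exact Or.inr (Or.inr (Or.inr (klein_Z0_eq h2 hn hlt h0 c4 hA hsq g)))
    · rcases klein_Z0_ne h2 hn hlt h0 c4 hsq g with h | h
      · exact Or.inr (Or.inl h)
      · exact Or.inr (Or.inr (Or.inl h))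

theorem c62 : Nonempty (Multiplicative (ZMod 6 × ZMod 2) ≃*
    Multiplicative (ZMod 2 × ZMod 2 × ZMod 3)) := by
  have e : ZMod 6 ≃+ ZMod 2 × ZMod 3 :=
    (ZMod.chineseRemainder (m := 2) (n := 3) (by norm_num)).toAddEquiv
  exact ⟨AddEquiv.toMultiplicative
    (AddEquiv.prodComm.trans (AddEquiv.prodCongr (AddEquiv.refl (ZMod 2)) e))⟩

theorem abcase [Finite G] (h2 : ∃ a b : G, Gen a b) (hn : commutator G = ⊥) (hc : ¬ IsCyclic G)
    (hlt : gp G < 6 * Nat.card G) :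
    Nonempty (G ≃* Multiplicative (ZMod 2 × ZMod 2)) ∨
    Nonempty (G ≃* Multiplicative (ZMod 4 × ZMod 2)) ∨
    Nonempty (G ≃* Multiplicative (ZMod 3 × ZMod 3)) ∨
    Nonempty (G ≃* Multiplicative (ZMod 2 × ZMod 2 × ZMod 3)) := by
  obtain ⟨e⟩ := ab_self hn
  have hc' : ¬ IsCyclic (Abelianization G) := fun _ => hc (cyc_of_equiv e)
  rw [gp_congr e, Nat.card_congr e.toEquiv] at hlt
  rcases ab_class (gen_quot _ of_surj h2) hc' hlt with ⟨⟨f⟩⟩ | ⟨⟨f⟩⟩ | ⟨⟨f⟩⟩ | ⟨⟨f⟩⟩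
  · exact Or.inl ⟨e.trans f⟩
  · exact Or.inr (Or.inl ⟨e.trans f⟩)
  · exact Or.inr (Or.inr (Or.inl ⟨e.trans f⟩))
  · obtain ⟨k⟩ := c62
    exact Or.inr (Or.inr (Or.inr ⟨(e.trans f).trans k⟩))

end GenPairs

/-- Let `G` be a finite non-cyclic 2-generated group. If the number of
ordered pairs `(x, y) ∈ G × G` with `⟨x, y⟩ = G` is strictly less than `6·|G|`, then `G`
is isomorphic to one of: `C2 × C2`, `D3`, `D4`, `Q8`, `C4 × C2`, `D6`, `C3 × C3`, `A4`,
or `C2 × C2 × C3`. -/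
theorem stmt_9 {G : Type*} [Group G] [Finite G] (hnc : ¬ IsCyclic G)
    (h2gen : ∃ a b : G, Subgroup.closure {a, b} = ⊤)
    (h : Nat.card {p : G × G | Subgroup.closure {p.1, p.2} = ⊤} < 6 * Nat.card G) :
    Nonempty (G ≃* Multiplicative (ZMod 2 × ZMod 2)) ∨
    Nonempty (G ≃* DihedralGroup 3) ∨
    Nonempty (G ≃* DihedralGroup 4) ∨
    Nonempty (G ≃* QuaternionGroup 2) ∨
    Nonempty (G ≃* Multiplicative (ZMod 4 × ZMod 2)) ∨
    Nonempty (G ≃* DihedralGroup 6) ∨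
    Nonempty (G ≃* Multiplicative (ZMod 3 × ZMod 3)) ∨
    Nonempty (G ≃* alternatingGroup (Fin 4)) ∨
    Nonempty (G ≃* Multiplicative (ZMod 2 × ZMod 2 × ZMod 3)) := by
  have h' : GenPairs.gp G < 6 * Nat.card G := h
  have h2' : ∃ a b : G, GenPairs.Gen a b := h2gen
  by_cases hn : commutator G = ⊥
  · rcases GenPairs.abcase h2' hn hnc h' with k | k | k | k <;> simp only [k, true_or, or_true]
  · rcases GenPairs.nonab h2' hn h' with k | k | k | k <;> simp only [k, true_or, or_true]
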